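/- arXiv:2505.23168 — 4 statements merged into one kernel-verified Lean document; each statement's English description precedes it below -/
import Mathlib

section
/- In the setting of the preceding construction (unital essential extension K ◁ E = extension of C, nondegenerately represented on H, X = H ⊗ l²(ℤ) ⊗ E, shift quasi-free automorphism Γ of T_X), let e ∈ K ⊂ E be a minimal projection, let A := e(T_X)e, and let γ := Γ|_{e(T_X)e} ∈ Aut(A). Then γ^N is an outer automorphism of A for every N ∈ ℤ∖{0}. -/
/-!  Common definitions: group actions on C*-algebras, ergodicity, outerness,
states, conditional expectations, nuclearity, Kirchberg algebras, amenability. -/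

noncomputable section

open scoped ComplexOrder MultiplierAlgebra

/-- An action of a group `G` on a (star) algebra `A` by ⋆-algebra automorphisms. -/
structure CStarAction (G A : Type) [Group G] [Add A] [Mul A] [SMul ℂ A] [Star A] where
  app : G → A ≃⋆ₐ[ℂ] A
  app_one : ∀ a : A, app 1 a = a
  app_mul : ∀ (g h : G) (a : A), app (g * h) a = app g (app h a)

/-- The trivial action of `G` on `A`. -/
def trivialCStarAction (G A : Type) [Group G] [Add A] [Mul A] [SMul ℂ A] [Star A] :
    CStarAction G A where
  app _ := StarAlgEquiv.refl ℂ A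
  app_one _ := rfl
  app_mul _ _ _ := rfl

/-- An automorphism of a unital C*-algebra is inner if it is `Ad u` for a unitary `u`. -/
def IsInnerAut {A : Type} [CStarAlgebra A] (φ : A ≃⋆ₐ[ℂ] A) : Prop :=
  ∃ u : A, u ∈ unitary A ∧ ∀ a : A, φ a = u * a * star u

/-- The fixed point set of an action. -/
def CStarAction.fixedPoints {G A : Type} [Group G] [Add A] [Mul A] [SMul ℂ A] [Star A]
    (α : CStarAction G A) : Set A :=
  {a : A | ∀ g : G, α.app g a = a}

/-- An action on a unital C*-algebra is ergodic if its fixed point algebra is `ℂ1`. -/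
def CStarAction.IsErgodic {G A : Type} [Group G] [CStarAlgebra A]
    (α : CStarAction G A) : Prop :=
  α.fixedPoints = Set.range (fun z : ℂ => z • (1 : A))

/-- An action is point-wise outer if `α g` is not inner for every `g ≠ 1`. -/
def CStarAction.IsPointwiseOuter {G A : Type} [Group G] [CStarAlgebra A]
    (α : CStarAction G A) : Prop :=
  ∀ g : G, g ≠ 1 → ¬ IsInnerAut (α.app g)

/-- A state on a unital C*-algebra. -/
structure IsState {A : Type} [CStarAlgebra A] (φ : A →ₗ[ℂ] ℂ) : Prop where
  map_one : φ 1 = 1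
  pos : ∀ a : A, 0 ≤ φ (star a * a)

/-- A `G`-invariant state. -/
structure IsInvariantState {G A : Type} [Group G] [CStarAlgebra A]
    (α : CStarAction G A) (φ : A →ₗ[ℂ] ℂ) extends IsState φ : Prop where
  invariant : ∀ (g : G) (a : A), φ (α.app g a) = φ a

/-- A conditional expectation of `A` onto the subalgebra (given as the subset) `S`. -/
structure IsConditionalExpectation {A : Type} [NonUnitalCStarAlgebra A]
    (P : A →ₗ[ℂ] A) (S : Set A) : Prop where
  mem : ∀ a : A, P a ∈ S
  fixes : ∀ a ∈ S, P a = a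
  contractive : ∀ a : A, ‖P a‖ ≤ ‖a‖
  positive : ∀ a : A, ∃ b : A, P (star a * a) = star b * b
  left_module : ∀ b ∈ S, ∀ a : A, P (b * a) = b * P a
  right_module : ∀ b ∈ S, ∀ a : A, P (a * b) = P a * b

/-- Complete positivity of a linear map between star algebras (positivity of all
matrix amplifications, where positivity is witnessed algebraically). -/
def IsCompletelyPositive {A B : Type} [NonUnitalRing A] [StarRing A] [Module ℂ A]
    [NonUnitalRing B] [StarRing B] [Module ℂ B] (φ : A →ₗ[ℂ] B) : Prop :=
  ∀ (n : ℕ) (M : Matrix (Fin n) (Fin n) A), (∃ N : Matrix (Fin n) (Fin n) A, M = N.conjTranspose * N) →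
    ∃ N' : Matrix (Fin n) (Fin n) B, M.map φ = N'.conjTranspose * N'

/-- Nuclearity of a C*-algebra, via the completely positive approximation property. -/
def IsNuclearCStar (A : Type) [NonUnitalCStarAlgebra A] : Prop :=
  ∀ (s : Finset A) (ε : ℝ), 0 < ε →
    ∃ (n : ℕ) (φ : A →ₗ[ℂ] Matrix (Fin n) (Fin n) ℂ) (ψ : Matrix (Fin n) (Fin n) ℂ →ₗ[ℂ] A),
      IsCompletelyPositive φ ∧ IsCompletelyPositive ψ ∧ ∀ a ∈ s, ‖ψ (φ a) - a‖ < ε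

/-- Simplicity: no non-trivial closed two-sided ideals (and `A ≠ 0`). -/
def IsSimpleCStarAlgebra (A : Type) [NonUnitalCStarAlgebra A] : Prop :=
  (∃ a : A, a ≠ 0) ∧
    ∀ I : TwoSidedIdeal A, IsClosed (I : Set A) → (I : Set A) = {0} ∨ (I : Set A) = Set.univ

/-- A unital Kirchberg algebra: separable, nuclear, simple, purely infinite (UCT not assumed). -/
structure IsUnitalKirchberg (A : Type) [CStarAlgebra A] : Prop where
  separable : TopologicalSpace.SeparableSpace A
  nuclear : IsNuclearCStar A
  simple : IsSimpleCStarAlgebra A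
  properly_infinite : ∃ s t : A, star s * s = 1 ∧ star t * t = 1 ∧ star s * t = 0
  purely_infinite : ∀ a : A, a ≠ 0 → ∃ x y : A, x * a * y = 1

/-- A (possibly non-unital) Kirchberg algebra. -/
structure IsKirchberg (A : Type) [NonUnitalCStarAlgebra A] : Prop where
  separable : TopologicalSpace.SeparableSpace A
  nuclear : IsNuclearCStar A
  simple : IsSimpleCStarAlgebra A
  purely_infinite : ∀ a b : A, a ≠ 0 → ∀ ε : ℝ, 0 < ε → ∃ x y : A, ‖x * a * y - b‖ < ε

/-- Amenability of a discrete group: existence of a left invariant finitely additive mean. -/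
def IsAmenableGroup (G : Type) [Group G] : Prop :=
  ∃ m : Set G → ℝ, (∀ s, 0 ≤ m s) ∧ m Set.univ = 1 ∧
    (∀ s t : Set G, Disjoint s t → m (s ∪ t) = m s + m t) ∧
    ∀ (g : G) (s : Set G), m ((g * ·) '' s) = m s

/-- A projection in a C*-algebra. -/
def IsProjectionElem {A : Type} [NonUnitalCStarAlgebra A] (p : A) : Prop :=
  star p = p ∧ p * p = p

/-- An approximate unit consisting of a strictly increasing sequence of projections. -/
def HasIncreasingProjApproxUnit (A : Type) [NonUnitalCStarAlgebra A] : Prop :=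
  ∃ p : ℕ → A, (∀ n, IsProjectionElem (p n)) ∧
    (∀ n, p n * p (n + 1) = p n ∧ p (n + 1) * p n = p n ∧ p n ≠ p (n + 1)) ∧
    ∀ x : A, Filter.Tendsto (fun n => ‖x - p n * x‖ + ‖x - x * p n‖) Filter.atTop (nhds 0)

/-- `A` has a unit. -/
def IsUnitalAlgebra (A : Type) [NonUnitalCStarAlgebra A] : Prop :=
  ∃ e : A, ∀ x : A, e * x = x ∧ x * e = x

end
noncomputable section

open scoped MultiplierAlgebra

/-- A bundled C*-algebra with an action of the group `G` (a "G-C*-algebra"). -/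
structure GCStar (G : Type) [Group G] where
  carrier : Type
  [inst : NonUnitalCStarAlgebra carrier]
  act : CStarAction G carrier

attribute [instance] GCStar.inst

/-- A `G`-equivariant ⋆-homomorphism between G-C*-algebras. -/
structure GHom (G : Type) [Group G] (A B : GCStar G) where
  hom : A.carrier →⋆ₙₐ[ℂ] B.carrier
  equivariant : ∀ (g : G) (a : A.carrier), hom (A.act.app g a) = B.act.app g (hom a)

namespace GHom

variable {G : Type} [Group G]

/-- The identity equivariant homomorphism. -/
def id (A : GCStar G) : GHom G A A where
  hom :=
    { toFun := fun a => a
      map_smul' := fun _ _ => rfl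
      map_zero' := rfl
      map_add' := fun _ _ => rfl
      map_mul' := fun _ _ => rfl
      map_star' := fun _ => rfl }
  equivariant _ _ := rfl

/-- Composition (in diagrammatic order: `f.comp g = g ∘ f`). -/
def comp {A B C : GCStar G} (f : GHom G A B) (g : GHom G B C) : GHom G A C where
  hom := g.hom.comp f.hom
  equivariant h a := by
    simp only [NonUnitalStarAlgHom.comp_apply, f.equivariant, g.equivariant]

end GHom

/-- Forget the `G`-action, yielding an object over the trivial group `PUnit`. -/
def GCStar.forget {G : Type} [Group G] (A : GCStar G) : GCStar PUnit :=
  { carrier := A.carrier, inst := A.inst, act := trivialCStarAction PUnit A.carrier }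

/-- Forget equivariance of a morphism. -/
def GHom.forget {G : Type} [Group G] {A B : GCStar G} (f : GHom G A B) :
    GHom PUnit A.forget B.forget :=
  { hom := f.hom, equivariant := fun _ _ => rfl }

/-- An (abstract) equivariant Kasparov `KK^G`-theory: a category structure on
G-C*-algebras whose morphisms are the `KK^G`-groups, receiving equivariant
⋆-homomorphisms and classes of cocycle morphisms, together with suspension, Bott
periodicity, mapping cones and exact triangles. -/
structure KKTheoryG (G : Type) [Group G] where
  KK : GCStar G → GCStar G → Type
  instAddCommGroup : ∀ A B, AddCommGroup (KK A B)
  unit : (A : GCStar G) → KK A A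
  comp : {A B C : GCStar G} → KK A B → KK B C → KK A C
  ofHom : {A B : GCStar G} → GHom G A B → KK A B
  ofCocycle : {A B : GCStar G} → (A.carrier →⋆ₙₐ[ℂ] B.carrier) →
    (G → 𝓜(ℂ, B.carrier)) → KK A B
  comp_assoc : ∀ {A B C D : GCStar G} (x : KK A B) (y : KK B C) (z : KK C D),
    comp (comp x y) z = comp x (comp y z)
  unit_comp : ∀ {A B : GCStar G} (x : KK A B), comp (unit A) x = x
  comp_unit : ∀ {A B : GCStar G} (x : KK A B), comp x (unit B) = x
  ofHom_id : ∀ A : GCStar G, ofHom (GHom.id A) = unit A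
  ofHom_comp : ∀ {A B C : GCStar G} (f : GHom G A B) (g : GHom G B C),
    ofHom (f.comp g) = comp (ofHom f) (ofHom g)
  ofCocycle_one : ∀ {A B : GCStar G} (f : GHom G A B),
    ofCocycle f.hom (fun _ => 1) = ofHom f
  susp : GCStar G → GCStar G
  suspGHom : {A B : GCStar G} → GHom G A B → GHom G (susp A) (susp B)
  suspKK : {A B : GCStar G} → KK A B → KK (susp A) (susp B)
  bott : (A : GCStar G) → KK A (susp (susp A))
  bott_invertible : ∀ A : GCStar G,
    ∃ y : KK (susp (susp A)) A, comp (bott A) y = unit A ∧ comp y (bott A) = unit (susp (susp A))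
  cone : {A B : GCStar G} → GHom G A B → GCStar G
  coneEval : {A B : GCStar G} → (f : GHom G A B) → GHom G (cone f) A
  coneIota : {A B : GCStar G} → (f : GHom G A B) → KK (susp B) (cone f)
  coneJ : {A B J : GCStar G} → (f : GHom G A B) → (l : GHom G J A) →
    (∀ x, f.hom (l.hom x) = 0) → KK J (cone f)
  exactTriangle : {X A B : GCStar G} → KK (susp X) A → KK A B → KK B X → Prop
  triangle_cone : ∀ {A B : GCStar G} (f : GHom G A B),
    exactTriangle (coneIota f) (ofHom (coneEval f)) (ofHom f)

attribute [instance] KKTheoryG.instAddCommGroup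

namespace KKTheoryG

variable {G : Type} [Group G]

/-- A class is a `KK^G`-equivalence if it is invertible for the Kasparov product. -/
def IsEquiv (kk : KKTheoryG G) {A B : GCStar G} (x : kk.KK A B) : Prop :=
  ∃ y : kk.KK B A, kk.comp x y = kk.unit A ∧ kk.comp y x = kk.unit B

end KKTheoryG

/-- Non-equivariant `KK`-theory, seen as `KK`-theory over the trivial group. -/
abbrev KKTheory := KKTheoryG PUnit

/-- The forgetful functor `F : KK^G → KK`. -/
structure KKForget {G : Type} [Group G] (kkG : KKTheoryG G) (kk : KKTheory) where
  map : ∀ {A B : GCStar G}, kkG.KK A B → kk.KK A.forget B.forget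
  map_ofHom : ∀ {A B : GCStar G} (f : GHom G A B), map (kkG.ofHom f) = kk.ofHom f.forget
  map_comp : ∀ {A B C : GCStar G} (x : kkG.KK A B) (y : kkG.KK B C),
    map (kkG.comp x y) = kk.comp (map x) (map y)
  map_unit : ∀ A : GCStar G, map (kkG.unit A) = kk.unit A.forget

/-- The unital homomorphism `ℂ → A`, `z ↦ z • 1`. -/
def unitHomC (A : Type) [CStarAlgebra A] : ℂ →⋆ₙₐ[ℂ] A where
  toFun z := z • (1 : A)
  map_smul' z w := by simp [smul_smul]
  map_zero' := by simp
  map_add' z w := by simp [add_smul]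
  map_mul' z w := by
    simp [smul_smul, smul_mul_smul_comm, mul_comm]
  map_star' z := by simp [star_smul, RCLike.star_def]

/-- Bundle an algebra with an action as a G-C*-algebra. -/
abbrev GCStar.of (G : Type) [Group G] (A : Type) [NonUnitalCStarAlgebra A]
    (α : CStarAction G A) : GCStar G :=
  { carrier := A, act := α }

/-- `ℂ` as a G-C*-algebra with the trivial action. -/
abbrev GCStar.C (G : Type) [Group G] : GCStar G :=
  GCStar.of G ℂ (trivialCStarAction G ℂ)

lemma StarAlgEquiv.map_one' {A : Type} [CStarAlgebra A] (e : A ≃⋆ₐ[ℂ] A) : e 1 = 1 := by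
  have h : e 1 * e 1 = e 1 := by rw [← map_mul]; simp
  have hsurj : Function.Surjective e := e.surjective
  have : ∀ y : A, e 1 * y = y := by
    intro y
    obtain ⟨x, rfl⟩ := hsurj y
    calc e 1 * e x = e (1 * x) := (map_mul e 1 x).symm
    _ = e x := by rw [one_mul]
  have h1 := this 1
  rwa [mul_one] at h1

/-- The unit `ℂ → A` as an equivariant morphism for any action on a unital `A`. -/
def unitGHom {G : Type} [Group G] (A : Type) [CStarAlgebra A] (α : CStarAction G A) :
    GHom G (GCStar.C G) (GCStar.of G A α) where
  hom := unitHomC A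
  equivariant g z := by
    have h : (α.app g) (z • (1 : A)) = z • (1 : A) := by
      rw [map_smul, StarAlgEquiv.map_one' (α.app g)]
    exact h.symm

/-- A unital ⋆-homomorphism as an equivariant morphism for the trivial actions. -/
def toTrivGHom {A B : Type} [CStarAlgebra A] [CStarAlgebra B] (f : A →⋆ₐ[ℂ] B) :
    GHom PUnit (GCStar.of PUnit A (trivialCStarAction PUnit A))
      (GCStar.of PUnit B (trivialCStarAction PUnit B)) where
  hom := f.toNonUnitalStarAlgHom
  equivariant _ _ := rfl

/-- A ⋆-homomorphism as an equivariant morphism for the trivial actions. -/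
def trivGHomOfHom {A B : Type} [NonUnitalCStarAlgebra A] [NonUnitalCStarAlgebra B]
    (f : A →⋆ₙₐ[ℂ] B) :
    GHom PUnit (GCStar.of PUnit A (trivialCStarAction PUnit A))
      (GCStar.of PUnit B (trivialCStarAction PUnit B)) where
  hom := f
  equivariant _ _ := rfl

/-- Matrix-unit data exhibiting `BK` as the stabilization `B ⊗ K(ℓ²(ι))` of `B`:
`θ i j b` plays the role of `b ⊗ e_{i,j}`. -/
structure MatrixUnitsData (ι B BK : Type) [DecidableEq ι] [NonUnitalCStarAlgebra B]
    [NonUnitalCStarAlgebra BK] where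
  θ : ι → ι → (B →ₗ[ℂ] BK)
  mul_rel : ∀ (i j k l : ι) (b c : B),
    θ i j b * θ k l c = if j = k then θ i l (b * c) else 0
  star_rel : ∀ (i j : ι) (b : B), star (θ i j b) = θ j i (star b)
  norm_rel : ∀ (i j : ι) (b : B), ‖θ i j b‖ = ‖b‖
  dense : closure (Submodule.span ℂ (⋃ i : ι, ⋃ j : ι, Set.range (θ i j)) : Set BK) = Set.univ

/-- The corner embedding `B → B ⊗ K` associated to a fixed minimal projection,
built from matrix-unit data. -/
def MatrixUnitsData.cornerHom {ι B BK : Type} [DecidableEq ι] [NonUnitalCStarAlgebra B]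
    [NonUnitalCStarAlgebra BK] (d : MatrixUnitsData ι B BK) (i : ι) : B →⋆ₙₐ[ℂ] BK where
  toFun b := d.θ i i b
  map_smul' z b := by simp
  map_zero' := by simp
  map_add' b c := by simp
  map_mul' b c := by rw [d.mul_rel]; simp
  map_star' b := by rw [d.star_rel]

end
noncomputable section

/-! The standing assumptions of the Pimsner construction (Sec. 4.1 of the paper),
encoded as a structure: `B` unital separable nuclear, `E` separable non-unital
nuclear containing `B ⊗ K` as an essential ideal, a non-degenerate representation
`E ⊆ B(H)` and a compatible unitary representation of `G`, together with the
Toeplitz--Pimsner algebra `T_X` of the G-Hilbert bimodule `X = H ⊗ ℓ²(G) ⊗ E`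
(presented by its creation operators `Tcr`), its gauge action and
the quasi-free `G`-action `Γ`. -/
structure PimsnerSetting (G : Type) [Group G] [DecidableEq G] where
  B : Type
  [instB : CStarAlgebra B]
  sepB : TopologicalSpace.SeparableSpace B
  nucB : IsNuclearCStar B
  BK : Type
  [instBK : NonUnitalCStarAlgebra BK]
  stab : MatrixUnitsData ℕ B BK
  E : Type
  [instE : NonUnitalCStarAlgebra E]
  sepE : TopologicalSpace.SeparableSpace E
  nucE : IsNuclearCStar E
  nonunitalE : ¬ IsUnitalAlgebra E
  approxE : HasIncreasingProjApproxUnit E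
  jBK : BK →⋆ₙₐ[ℂ] E
  jBK_inj : Function.Injective jBK
  ideal_left : ∀ (x : E) (y : BK), x * jBK y ∈ Set.range jBK
  ideal_right : ∀ (x : E) (y : BK), jBK y * x ∈ Set.range jBK
  essential : ∀ x : E, (∀ y : BK, x * jBK y = 0) → x = 0
  H : Type
  [instH : NormedAddCommGroup H]
  [instH2 : InnerProductSpace ℂ H]
  [instH3 : CompleteSpace H]
  rep : E →⋆ₙₐ[ℂ] (H →L[ℂ] H)
  rep_inj : Function.Injective rep
  rep_nondeg : ∀ ζ : H, (∀ x : E, rep x ζ = 0) → ζ = 0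
  U : G → (H →L[ℂ] H)
  U_unitary : ∀ g, U g ∈ unitary (H →L[ℂ] H)
  U_mul : ∀ g h, U (g * h) = U g * U h
  αE : CStarAction G E
  αE_rep : ∀ g x, rep (αE.app g x) = U g * rep x * star (U g)
  αE_BK : ∀ g y, αE.app g (jBK y) ∈ Set.range jBK
  U_fix : ∀ g, U g * rep (jBK (stab.θ 0 0 1)) = rep (jBK (stab.θ 0 0 1))
  fix_U : ∀ g, rep (jBK (stab.θ 0 0 1)) * U g = rep (jBK (stab.θ 0 0 1))
  TX : Type
  [instTX : NonUnitalCStarAlgebra TX]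
  ιE : E →⋆ₙₐ[ℂ] TX
  ιE_inj : Function.Injective ιE
  Tcr : H → G → E → TX
  Tcr_addH : ∀ ζ ξ h x, Tcr (ζ + ξ) h x = Tcr ζ h x + Tcr ξ h x
  Tcr_smulH : ∀ (c : ℂ) ζ h x, Tcr (c • ζ) h x = c • Tcr ζ h x
  Tcr_addE : ∀ ζ h x y, Tcr ζ h (x + y) = Tcr ζ h x + Tcr ζ h y
  Tcr_right : ∀ ζ h x y, Tcr ζ h x * ιE y = Tcr ζ h (x * y)
  Tcr_left : ∀ a ζ h x, ιE a * Tcr ζ h x = Tcr (rep a ζ) h x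
  Tcr_star : ∀ ζ h x ξ k y,
    star (Tcr ζ h x) * Tcr ξ k y = if h = k then (inner ℂ ζ ξ : ℂ) • ιE (star x * y) else 0
  generates : closure ((NonUnitalStarAlgebra.adjoin ℂ
      {t : TX | ∃ ζ h x, t = Tcr ζ h x} : NonUnitalStarSubalgebra ℂ TX) : Set TX) = Set.univ
  vac : TX →ₗ[ℂ] E
  vac_ι : ∀ x, vac (ιE x) = x
  vac_creation : ∀ ζ h x t, vac (Tcr ζ h x * t) = 0
  vac_annihilation : ∀ ζ h x t, vac (t * star (Tcr ζ h x)) = 0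
  vac_cr : ∀ ζ h x, vac (Tcr ζ h x) = 0
  vac_positive : ∀ t, ∃ y, vac (star t * t) = star y * y
  vac_contractive : ∀ t, ‖vac t‖ ≤ ‖t‖
  gauge : CStarAction Circle TX
  gauge_cr : ∀ z ζ h x, gauge.app z (Tcr ζ h x) = (z : ℂ) • Tcr ζ h x
  gauge_ι : ∀ z x, gauge.app z (ιE x) = ιE x
  Γ : CStarAction G TX
  Γ_cr : ∀ g ζ h x, Γ.app g (Tcr ζ h x) = Tcr (U g ζ) (g * h) (αE.app g x)
  Γ_ι : ∀ g x, Γ.app g (ιE x) = ιE (αE.app g x)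

attribute [instance] PimsnerSetting.instB PimsnerSetting.instBK PimsnerSetting.instE
  PimsnerSetting.instH PimsnerSetting.instH2 PimsnerSetting.instH3 PimsnerSetting.instTX

namespace PimsnerSetting

variable {G : Type} [Group G] [DecidableEq G] (S : PimsnerSetting G)

/-- The projection `1_B ⊗ e₀ ∈ B ⊗ K ⊆ E`. -/
def unitProj : S.E := S.jBK (S.stab.θ 0 0 1)

/-- The projection `1_B ⊗ e₀`, viewed in `T_X`. -/
def unitProjT : S.TX := S.ιE S.unitProj

/-- The corner `A_E = (1_B ⊗ e₀) T_X (1_B ⊗ e₀)`. -/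
def corner : Set S.TX := {y : S.TX | S.unitProjT * y = y ∧ y * S.unitProjT = y}

/-- The unital embedding `ι : B → A_E`, `b ↦ b ⊗ e₀`. -/
def cornerEmb : S.B → S.TX := fun b => S.ιE (S.jBK (S.stab.θ 0 0 b))

end PimsnerSetting

/-! The setting of Sec. 3 of the paper: a unital essential extension `K ◁ E`
of `C` by the compacts, non-degenerately represented on `H`, the Toeplitz--Pimsner
algebra `T_X` of `X = H ⊗ ℓ²(ℤ) ⊗ E`, and the shift quasi-free automorphism `Γ`
(given as a `ℤ`-action). -/
structure ToeplitzShiftSetting where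
  H : Type
  [instH : NormedAddCommGroup H]
  [instH2 : InnerProductSpace ℂ H]
  [instH3 : CompleteSpace H]
  E : Type
  [instE : CStarAlgebra E]
  sepE : TopologicalSpace.SeparableSpace E
  rep : E →⋆ₐ[ℂ] (H →L[ℂ] H)
  rep_inj : Function.Injective rep
  compacts_sub : ∀ T : H →L[ℂ] H, IsCompactOperator (⇑T) → T ∈ Set.range rep
  id_not_compact : ¬ IsCompactOperator (⇑(1 : H →L[ℂ] H))
  C : Type
  [instC : CStarAlgebra C]
  sepC : TopologicalSpace.SeparableSpace C
  nucC : IsNuclearCStar C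
  quot : E →⋆ₐ[ℂ] C
  quot_surj : Function.Surjective quot
  quot_ker : ∀ x : E, quot x = 0 ↔ IsCompactOperator (⇑(rep x))
  TX : Type
  [instTX : CStarAlgebra TX]
  ιE : E →⋆ₐ[ℂ] TX
  ιE_inj : Function.Injective ιE
  Tcr : H → ℤ → E → TX
  Tcr_addH : ∀ ζ ξ n x, Tcr (ζ + ξ) n x = Tcr ζ n x + Tcr ξ n x
  Tcr_smulH : ∀ (c : ℂ) ζ n x, Tcr (c • ζ) n x = c • Tcr ζ n x
  Tcr_addE : ∀ ζ n x y, Tcr ζ n (x + y) = Tcr ζ n x + Tcr ζ n y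
  Tcr_right : ∀ ζ n x y, Tcr ζ n x * ιE y = Tcr ζ n (x * y)
  Tcr_left : ∀ a ζ n x, ιE a * Tcr ζ n x = Tcr (rep a ζ) n x
  Tcr_star : ∀ ζ m x ξ n y,
    star (Tcr ζ m x) * Tcr ξ n y = if m = n then (inner ℂ ζ ξ : ℂ) • ιE (star x * y) else 0
  generates : closure ((NonUnitalStarAlgebra.adjoin ℂ
      {t : TX | ∃ ζ n x, t = Tcr ζ n x} : NonUnitalStarSubalgebra ℂ TX) : Set TX) = Set.univ
  vac : TX →ₗ[ℂ] E
  vac_ι : ∀ x, vac (ιE x) = x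
  vac_creation : ∀ ζ n x t, vac (Tcr ζ n x * t) = 0
  vac_annihilation : ∀ ζ n x t, vac (t * star (Tcr ζ n x)) = 0
  vac_cr : ∀ ζ n x, vac (Tcr ζ n x) = 0
  Γ : CStarAction (Multiplicative ℤ) TX
  Γ_cr : ∀ (n : ℤ) ζ m x,
    Γ.app (Multiplicative.ofAdd n) (Tcr ζ m x) = Tcr ζ (n + m) x
  Γ_ι : ∀ (n : ℤ) (x : E), Γ.app (Multiplicative.ofAdd n) (ιE x) = ιE x

attribute [instance] ToeplitzShiftSetting.instH ToeplitzShiftSetting.instH2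
  ToeplitzShiftSetting.instH3 ToeplitzShiftSetting.instE ToeplitzShiftSetting.instC
  ToeplitzShiftSetting.instTX

end
namespace ToeplitzShiftSetting

variable (S : ToeplitzShiftSetting)

/-- Monomials in the creation operators and `E`. -/
inductive Mon : S.TX → Prop
  | base (x : S.E) : Mon (S.ιE x)
  | step (ζ : S.H) (n : ℤ) (x : S.E) (a : S.TX) (ha : Mon a) : Mon (S.Tcr ζ n x * a)

lemma Mon.iota_mul {S : ToeplitzShiftSetting} (x : S.E) {a : S.TX} (ha : S.Mon a) :
    S.Mon (S.ιE x * a) := by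
  cases ha with
  | base y => rw [← map_mul]; exact Mon.base _
  | step ζ n y a ha =>
    rw [← mul_assoc, S.Tcr_left]
    exact Mon.step _ _ _ _ ha

lemma Mon.mul {S : ToeplitzShiftSetting} {a b : S.TX} (ha : S.Mon a) (hb : S.Mon b) :
    S.Mon (a * b) := by
  induction ha with
  | base x => exact hb.iota_mul x
  | step ζ n x a _ ih => rw [mul_assoc]; exact Mon.step _ _ _ _ ih

lemma Mon.cr {S : ToeplitzShiftSetting} (ζ : S.H) (n : ℤ) (x : S.E) : S.Mon (S.Tcr ζ n x) := by
  have h := Mon.step ζ n x _ (Mon.base (S := S) 1)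
  simpa using h

/-- Span of the Wick ordered words. -/
noncomputable def Wick : Submodule ℂ S.TX :=
  Submodule.span ℂ {t | ∃ a b, S.Mon a ∧ S.Mon b ∧ t = a * star b}

lemma wick_mul_left (c : S.TX)
    (h : ∀ a b, S.Mon a → S.Mon b → c * (a * star b) ∈ S.Wick) :
    ∀ q ∈ S.Wick, c * q ∈ S.Wick := by
  intro q hq
  unfold Wick at hq
  induction hq using Submodule.span_induction with
  | mem t ht => obtain ⟨a, b, ha, hb, rfl⟩ := ht; exact h a b ha hb
  | zero => simp
  | add x y _ _ hx hy => rw [mul_add]; exact add_mem hx hy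
  | smul z x _ hx => rw [mul_smul_comm]; exact Submodule.smul_mem _ _ hx

lemma wick_mem {a b : S.TX} (ha : S.Mon a) (hb : S.Mon b) : a * star b ∈ S.Wick :=
  Submodule.subset_span ⟨a, b, ha, hb, rfl⟩

lemma wick_cr (ζ : S.H) (n : ℤ) (x : S.E) : ∀ q ∈ S.Wick, S.Tcr ζ n x * q ∈ S.Wick := by
  apply S.wick_mul_left
  intro a b ha hb
  rw [← mul_assoc]
  exact S.wick_mem (Mon.step _ _ _ _ ha) hb

lemma wick_star_cr (ζ : S.H) (n : ℤ) (x : S.E) :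
    ∀ q ∈ S.Wick, star (S.Tcr ζ n x) * q ∈ S.Wick := by
  apply S.wick_mul_left
  intro a b ha hb
  cases ha with
  | base y =>
    have h : star (S.Tcr ζ n x) * (S.ιE y * star b)
        = S.ιE 1 * star (b * (S.ιE (star y) * S.Tcr ζ n x)) := by
      simp [mul_assoc, map_star S.ιE y]
    rw [h]
    exact S.wick_mem (Mon.base _) (hb.mul ((Mon.cr ζ n x).iota_mul _))
  | step ξ m y a ha =>
    have h : star (S.Tcr ζ n x) * (S.Tcr ξ m y * a * star b)
        = (star (S.Tcr ζ n x) * S.Tcr ξ m y) * (a * star b) := by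
      simp only [mul_assoc]
    rw [h, S.Tcr_star]
    split_ifs
    · rw [smul_mul_assoc, ← mul_assoc]
      exact Submodule.smul_mem _ _ (S.wick_mem (ha.iota_mul _) hb)
    · simp

lemma adjoin_sub_wick (t : S.TX) (ht : t ∈ (NonUnitalStarAlgebra.adjoin ℂ
      {t : S.TX | ∃ ζ n x, t = S.Tcr ζ n x} : NonUnitalStarSubalgebra ℂ S.TX)) :
    t ∈ S.Wick := by
  have key : (∀ q ∈ S.Wick, t * q ∈ S.Wick) ∧ (∀ q ∈ S.Wick, star t * q ∈ S.Wick) := by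
    induction ht using NonUnitalStarAlgebra.adjoin_induction with
    | mem t ht =>
      obtain ⟨ζ, n, x, rfl⟩ := ht
      exact ⟨S.wick_cr ζ n x, S.wick_star_cr ζ n x⟩
    | add x y _ _ hx hy =>
      refine ⟨fun q hq => ?_, fun q hq => ?_⟩
      · rw [add_mul]; exact add_mem (hx.1 q hq) (hy.1 q hq)
      · rw [star_add, add_mul]; exact add_mem (hx.2 q hq) (hy.2 q hq)
    | zero => simp
    | mul x y _ _ hx hy =>
      refine ⟨fun q hq => ?_, fun q hq => ?_⟩
      · rw [mul_assoc]; exact hx.1 _ (hy.1 q hq)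
      · rw [star_mul, mul_assoc]; exact hy.2 _ (hx.2 q hq)
    | smul r x _ hx =>
      refine ⟨fun q hq => ?_, fun q hq => ?_⟩
      · rw [smul_mul_assoc]; exact Submodule.smul_mem _ _ (hx.1 q hq)
      · rw [star_smul, smul_mul_assoc]; exact Submodule.smul_mem _ _ (hx.2 q hq)
    | star x _ hx => exact ⟨hx.2, by rw [star_star]; exact hx.1⟩
  have h1 : (1 : S.TX) ∈ S.Wick := by
    have := S.wick_mem (Mon.base 1) (Mon.base 1)
    simpa using this
  simpa using key.1 1 h1

lemma wick_killed (N : ℤ) (hN : N ≠ 0) (ζ : S.H) (e : S.E) (q : S.TX) (hq : q ∈ S.Wick) :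
    ∀ᶠ n : ℤ in Filter.atTop, star (S.Tcr ζ (N + n) e) * q * S.Tcr ζ n e = 0 := by
  unfold Wick at hq
  induction hq using Submodule.span_induction with
  | mem t ht =>
    obtain ⟨a, b, ha, hb, rfl⟩ := ht
    cases ha with
    | step ξ m y a ha =>
      filter_upwards [Filter.eventually_gt_atTop (m - N)] with n hn
      have h : star (S.Tcr ζ (N + n) e) * (S.Tcr ξ m y * a * star b) * S.Tcr ζ n e
          = (star (S.Tcr ζ (N + n) e) * S.Tcr ξ m y) * (a * star b * S.Tcr ζ n e) := by
        simp only [mul_assoc]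
      rw [h, S.Tcr_star, if_neg (by omega), zero_mul]
    | base x =>
      cases hb with
      | base y =>
        refine Filter.Eventually.of_forall fun n => ?_
        rw [← map_star, ← map_mul, mul_assoc, S.Tcr_left, S.Tcr_star, if_neg (by omega)]
      | step ξ m y b hb =>
        filter_upwards [Filter.eventually_gt_atTop m] with n hn
        rw [star_mul]
        have h : star (S.Tcr ζ (N + n) e) * (S.ιE x * (star b * star (S.Tcr ξ m y)))
              * S.Tcr ζ n e
            = star (S.Tcr ζ (N + n) e) * (S.ιE x * star b)
              * (star (S.Tcr ξ m y) * S.Tcr ζ n e) := by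
          simp only [mul_assoc]
        rw [h, S.Tcr_star, if_neg (by omega), mul_zero]
  | zero => simp
  | add x y _ _ hx hy =>
    filter_upwards [hx, hy] with n h1 h2
    rw [mul_add, add_mul, h1, h2, add_zero]
  | smul z x _ hx =>
    filter_upwards [hx] with n h1
    rw [mul_smul_comm, smul_mul_assoc, h1, smul_zero]

end ToeplitzShiftSetting

/-- In the Toeplitz--Pimsner shift setting, for a minimal projection
`e ∈ K ⊆ E` the restriction `γ = Γ|` to the corner `A = e T_X e` has `γ^N` outer for
every `N ∈ ℤ∖{0}`. -/
theorem toeplitz_shift_corner_outer (S : ToeplitzShiftSetting) (e : S.E)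
    (he : IsProjectionElem e)
    (hcompact : IsCompactOperator (⇑(S.rep e)))
    (hrank1 : ∃ ζ₀ : S.H, ‖ζ₀‖ = 1 ∧ ∀ ξ : S.H, S.rep e ξ = (inner ℂ ζ₀ ξ : ℂ) • ζ₀) :
    ∀ N : ℤ, N ≠ 0 →
      ¬ ∃ V : S.TX, (S.ιE e * V = V ∧ V * S.ιE e = V) ∧
          star V * V = S.ιE e ∧ V * star V = S.ιE e ∧
          ∀ y : S.TX, (S.ιE e * y = y ∧ y * S.ιE e = y) →
            S.Γ.app (Multiplicative.ofAdd N) y = V * y * star V := by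
  rintro N hN ⟨V, ⟨hV1, hV2⟩, hVV, -, hAd⟩
  obtain ⟨ζ, hζ, hrep⟩ := hrank1
  obtain ⟨hes, hee⟩ := he
  have hin : (inner ℂ ζ ζ : ℂ) = 1 := by
    rw [inner_self_eq_norm_sq_to_K, hζ]; simp
  have hrz : S.rep e ζ = ζ := by rw [hrep, hin, one_smul]
  have hTT : ∀ n, star (S.Tcr ζ n e) * S.Tcr ζ n e = S.ιE e := by
    intro n
    rw [S.Tcr_star, if_pos rfl, hin, one_smul, hes, hee]
  have hcomm : ∀ n, V * S.Tcr ζ n e = S.Tcr ζ (N + n) e * V := by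
    intro n
    have h1 : S.Tcr ζ n e * S.ιE e = S.Tcr ζ n e := by rw [S.Tcr_right, hee]
    have h := hAd (S.Tcr ζ n e) ⟨by rw [S.Tcr_left, hrz], h1⟩
    rw [S.Γ_cr] at h
    rw [h, mul_assoc, hVV, mul_assoc, h1]
  have hcompress : ∀ n, star (S.Tcr ζ (N + n) e) * V * S.Tcr ζ n e = V := by
    intro n
    rw [mul_assoc, hcomm, ← mul_assoc, hTT, hV1]
  have hnorm : ∀ n, ‖S.Tcr ζ n e‖ ≤ ‖S.ιE e‖ + 1 := by
    intro n
    have h := CStarRing.norm_star_mul_self (x := S.Tcr ζ n e)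
    rw [hTT] at h
    nlinarith [norm_nonneg (S.Tcr ζ n e), norm_nonneg (S.ιE e), sq_nonneg (‖S.Tcr ζ n e‖ - 1)]
  have hV0 : V = 0 := by
    by_contra hne
    have hpos : 0 < ‖V‖ := norm_pos_iff.mpr hne
    set c := ‖S.ιE e‖ + 1 with hc
    have hcpos : 0 < c := by positivity
    have hmem : V ∈ closure ((NonUnitalStarAlgebra.adjoin ℂ
      {t : S.TX | ∃ ζ n x, t = S.Tcr ζ n x} : NonUnitalStarSubalgebra ℂ S.TX) : Set S.TX) := by
      rw [S.generates]; trivial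
    obtain ⟨W, hW, hd⟩ := Metric.mem_closure_iff.mp hmem (‖V‖ / (c * c)) (by positivity)
    obtain ⟨n, hn⟩ := (S.wick_killed N hN ζ e W (S.adjoin_sub_wick W hW)).exists
    have hVe : V = star (S.Tcr ζ (N + n) e) * (V - W) * S.Tcr ζ n e := by
      rw [mul_sub, sub_mul, hn, sub_zero, hcompress]
    have hle : ‖V‖ ≤ c * ‖V - W‖ * c := by
      calc ‖V‖ = ‖star (S.Tcr ζ (N + n) e) * (V - W) * S.Tcr ζ n e‖ := by rw [← hVe]
        _ ≤ ‖star (S.Tcr ζ (N + n) e)‖ * ‖V - W‖ * ‖S.Tcr ζ n e‖ := norm_mul₃_le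
        _ ≤ c * ‖V - W‖ * c := by
          rw [norm_star]
          gcongr
          · exact hnorm _
          · exact hnorm _
    rw [dist_eq_norm, lt_div_iff₀ (by positivity)] at hd
    nlinarith
  have he0 : e = 0 := by
    apply S.ιE_inj
    rw [← hVV, hV0, map_zero, mul_zero]
  rw [he0, map_zero] at hrz
  have : ζ = 0 := by rw [← hrz]; rfl
  rw [this, norm_zero] at hζ
  exact zero_ne_one hζ
end

section
/- Under the standing assumptions of the Pimsner construction (see context), let γ^E := Γ| be the restriction of the quasi-free G-action to the corner A_E := (1_B⊗e₀)(T_X)(1_B⊗e₀). Then for every g ∈ G∖{e}, the automorphism γ^E_g of A_E is outer. -/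
namespace PimsnerSetting

variable {G : Type} [Group G] [DecidableEq G] (S : PimsnerSetting G)

/-- Linear combinations of reduced words in the creation operators. -/
inductive Good : S.TX → Prop
  | emb (a : S.E) : Good (S.ιE a)
  | cr (ζ : S.H) (h : G) (x : S.E) : Good (S.Tcr ζ h x)
  | ann (ζ : S.H) (h : G) (x : S.E) : Good (star (S.Tcr ζ h x))
  | cr_mul (ζ : S.H) (h : G) (x : S.E) (t : S.TX) : Good t → Good (S.Tcr ζ h x * t)
  | mul_ann (ζ : S.H) (h : G) (x : S.E) (t : S.TX) : Good (t * star (S.Tcr ζ h x))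
  | sum (s t : S.TX) : Good s → Good t → Good (s + t)
  | smul (c : ℂ) (t : S.TX) : Good t → Good (c • t)

lemma ann_emb (ζ : S.H) (h : G) (x a : S.E) :
    star (S.Tcr ζ h x) * S.ιE a = star (S.Tcr (S.rep (star a) ζ) h x) := by
  rw [← S.Tcr_left, star_mul, ← map_star, star_star]

lemma good_zero : S.Good 0 := by
  have := Good.emb (S := S) 0
  rwa [map_zero] at this

lemma good_emb_mul (a : S.E) (t : S.TX) (ht : S.Good t) : S.Good (S.ιE a * t) := by
  induction ht with
  | emb b => rw [← map_mul]; exact Good.emb _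
  | cr ζ h x => rw [S.Tcr_left]; exact Good.cr _ _ _
  | ann ζ h x => exact Good.mul_ann _ _ _ _
  | cr_mul ζ h x t ht _ => rw [← mul_assoc, S.Tcr_left]; exact Good.cr_mul _ _ _ _ ht
  | mul_ann ζ h x t => rw [← mul_assoc]; exact Good.mul_ann _ _ _ _
  | sum s t _ _ h1 h2 => rw [mul_add]; exact Good.sum _ _ h1 h2
  | smul c t _ h1 => rw [mul_smul_comm]; exact Good.smul _ _ h1

lemma good_ann_mul (ξ : S.H) (k : G) (y : S.E) (t : S.TX) (ht : S.Good t) :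
    S.Good (star (S.Tcr ξ k y) * t) := by
  induction ht with
  | emb b => rw [S.ann_emb]; exact Good.ann _ _ _
  | cr ζ h x =>
    rw [S.Tcr_star]
    split_ifs
    · exact Good.smul _ _ (Good.emb _)
    · exact S.good_zero
  | ann ζ h x => exact Good.mul_ann _ _ _ _
  | cr_mul ζ h x t ht _ =>
    rw [← mul_assoc, S.Tcr_star]
    split_ifs
    · rw [smul_mul_assoc]
      exact Good.smul _ _ (S.good_emb_mul _ _ ht)
    · rw [zero_mul]; exact S.good_zero
  | mul_ann ζ h x t => rw [← mul_assoc]; exact Good.mul_ann _ _ _ _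
  | sum s t _ _ h1 h2 => rw [mul_add]; exact Good.sum _ _ h1 h2
  | smul c t _ h1 => rw [mul_smul_comm]; exact Good.smul _ _ h1

lemma good_of_mem_adjoin (t : S.TX)
    (ht : t ∈ NonUnitalStarAlgebra.adjoin ℂ {t : S.TX | ∃ ζ h x, t = S.Tcr ζ h x}) :
    S.Good t := by
  have ht' : t ∈ NonUnitalAlgebra.adjoin ℂ
      ({t : S.TX | ∃ ζ h x, t = S.Tcr ζ h x} ∪ star {t : S.TX | ∃ ζ h x, t = S.Tcr ζ h x}) := ht
  have key : S.Good t ∧ ∀ w, S.Good w → S.Good (t * w) := by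
    induction ht' using NonUnitalAlgebra.adjoin_induction with
    | mem x hx =>
      rcases hx with ⟨ζ, h, x, rfl⟩ | hx
      · exact ⟨Good.cr _ _ _, fun w hw => Good.cr_mul _ _ _ _ hw⟩
      · obtain ⟨ζ, h, y, hy⟩ := hx
        rw [← star_star x, hy]
        exact ⟨Good.ann _ _ _, fun w hw => S.good_ann_mul _ _ _ _ hw⟩
    | add x y _ _ h1 h2 =>
      refine ⟨Good.sum _ _ (h1 ?_).1 (h2 ?_).1, fun w hw => ?_⟩
      all_goals first
        | (rw [add_mul]; exact Good.sum _ _ ((h1 ‹_›).2 w hw) ((h2 ‹_›).2 w hw))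
        | assumption
    | zero => exact ⟨S.good_zero, fun w _ => by rw [zero_mul]; exact S.good_zero⟩
    | mul x y _ _ h1 h2 =>
      refine ⟨(h1 ?_).2 _ (h2 ?_).1, fun w hw => ?_⟩
      all_goals first
        | (rw [mul_assoc]; exact (h1 ‹_›).2 _ ((h2 ‹_›).2 w hw))
        | assumption
    | smul c x _ h1 =>
      refine ⟨Good.smul _ _ (h1 ?_).1, fun w hw => ?_⟩
      all_goals first
        | (rw [smul_mul_assoc]; exact Good.smul _ _ ((h1 ‹_›).2 w hw))
        | assumption
  exact key.1

/-- Compressions of reduced words by far away creation operators vanish. -/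
lemma good_compress (ζ : S.H) (p : S.E) (g : G) (hg : g ≠ 1) (t : S.TX) (ht : S.Good t) :
    ∃ F : Finset G, ∀ h ∉ F, star (S.Tcr ζ (g * h) p) * t * S.Tcr ζ h p = 0 := by
  induction ht with
  | emb a =>
    refine ⟨∅, fun h _ => ?_⟩
    rw [mul_assoc, S.Tcr_left, S.Tcr_star, if_neg]
    intro e
    exact hg (mul_eq_right.mp e)
  | cr ξ k x =>
    refine ⟨{g⁻¹ * k}, fun h hh => ?_⟩
    rw [S.Tcr_star, if_neg, zero_mul]
    rintro rfl
    simp at hh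
  | ann ξ k x =>
    refine ⟨{k}, fun h hh => ?_⟩
    rw [mul_assoc, S.Tcr_star, if_neg, mul_zero]
    rintro rfl
    simp at hh
  | cr_mul ξ k x t _ _ =>
    refine ⟨{g⁻¹ * k}, fun h hh => ?_⟩
    rw [← mul_assoc, S.Tcr_star, if_neg, zero_mul, zero_mul]
    rintro rfl
    simp at hh
  | mul_ann ξ k x t =>
    refine ⟨{k}, fun h hh => ?_⟩
    rw [mul_assoc, mul_assoc, S.Tcr_star, if_neg, mul_zero, mul_zero]
    rintro rfl
    simp at hh
  | sum s t _ _ h1 h2 =>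
    obtain ⟨F1, h1⟩ := h1
    obtain ⟨F2, h2⟩ := h2
    refine ⟨F1 ∪ F2, fun h hh => ?_⟩
    rw [Finset.mem_union, not_or] at hh
    rw [mul_add, add_mul, h1 h hh.1, h2 h hh.2, add_zero]
  | smul c t _ h1 =>
    obtain ⟨F1, h1⟩ := h1
    refine ⟨F1, fun h hh => ?_⟩
    rw [mul_smul_comm, smul_mul_assoc, h1 h hh, smul_zero]

lemma unitProj_star : star S.unitProj = S.unitProj := by
  rw [unitProj, ← map_star, S.stab.star_rel, star_one]

lemma unitProj_mul : S.unitProj * S.unitProj = S.unitProj := by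
  rw [unitProj, ← map_mul, S.stab.mul_rel, if_pos rfl, one_mul]

lemma unitProj_ne_zero : S.unitProj ≠ 0 := by
  intro h0
  have h1 : S.stab.θ 0 0 1 = 0 := S.jBK_inj (by rw [map_zero]; exact h0)
  have h2 : ‖(1 : S.B)‖ = 0 := by rw [← S.stab.norm_rel 0 0 1, h1, norm_zero]
  have h3 : (1 : S.B) = 0 := norm_eq_zero.mp h2
  have h4 : ∀ b : S.B, b = 0 := fun b => by rw [← mul_one b, h3, mul_zero]
  have h5 : Submodule.span ℂ (⋃ i : ℕ, ⋃ j : ℕ, Set.range (S.stab.θ i j)) = ⊥ := by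
    rw [Submodule.span_eq_bot]
    intro x hx
    simp only [Set.mem_iUnion, Set.mem_range] at hx
    obtain ⟨i, j, b, rfl⟩ := hx
    rw [h4 b, map_zero]
  have h6 := S.stab.dense
  rw [h5] at h6
  have h7 : ∀ y : S.BK, y = 0 := by
    intro y
    have : y ∈ closure ((⊥ : Submodule ℂ S.BK) : Set S.BK) := by rw [h6]; trivial
    simpa using this
  have h8 : ∀ x : S.E, x = 0 := fun x => S.essential x fun y => by
    rw [h7 y, map_zero, mul_zero]
  exact S.nonunitalE ⟨0, fun x => ⟨by rw [h8 x, mul_zero], by rw [h8 x, mul_zero]⟩⟩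

lemma αE_unitProj (g : G) : S.αE.app g S.unitProj = S.unitProj := by
  apply S.rep_inj
  have h1 : star (S.rep S.unitProj) = S.rep S.unitProj := by rw [← map_star, S.unitProj_star]
  have h2 : S.U g * S.rep S.unitProj = S.rep S.unitProj := S.U_fix g
  rw [S.αE_rep, h2]
  calc S.rep S.unitProj * star (S.U g) = star (S.U g * S.rep S.unitProj) := by
        rw [star_mul, h1]
    _ = S.rep S.unitProj := by rw [h2, h1]

lemma exists_unit_vector : ∃ ζ : S.H, S.rep S.unitProj ζ = ζ ∧ (inner ℂ ζ ζ : ℂ) = 1 := by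
  have h1 : S.rep S.unitProj ≠ 0 := fun h =>
    S.unitProj_ne_zero (S.rep_inj (by rw [h, map_zero]))
  obtain ⟨ξ, hξ⟩ : ∃ ξ, S.rep S.unitProj ξ ≠ 0 := by
    by_contra hc
    push Not at hc
    exact h1 (ContinuousLinearMap.ext hc)
  have hidem : S.rep S.unitProj (S.rep S.unitProj ξ) = S.rep S.unitProj ξ := by
    have := congrArg (fun T : S.H →L[ℂ] S.H => T ξ) (map_mul S.rep S.unitProj S.unitProj)
    rw [S.unitProj_mul] at this
    exact this.symm
  refine ⟨((‖S.rep S.unitProj ξ‖ : ℂ)⁻¹) • S.rep S.unitProj ξ, ?_, ?_⟩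
  · rw [map_smul, hidem]
  · have hn : ‖((‖S.rep S.unitProj ξ‖ : ℂ)⁻¹) • S.rep S.unitProj ξ‖ = 1 :=
      norm_smul_inv_norm (𝕜 := ℂ) hξ
    rw [inner_self_eq_norm_sq_to_K, hn]
    simp

end PimsnerSetting

/-- Under the standing assumptions of the Pimsner construction, the
restriction `γ^E = Γ|` of the quasi-free `G`-action to the corner
`A_E = (1_B⊗e₀) T_X (1_B⊗e₀)` is outer for every `g ≠ e`. -/
theorem pimsner_corner_action_pointwise_outer
    (G : Type) [Group G] [DecidableEq G] [Countable G] [Infinite G]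
    (S : PimsnerSetting G) :
    ∀ g : G, g ≠ 1 →
      ¬ ∃ V : S.TX, V ∈ S.corner ∧
          star V * V = S.unitProjT ∧ V * star V = S.unitProjT ∧
          ∀ y ∈ S.corner, S.Γ.app g y = V * y * star V := by
  rintro g hg ⟨V, ⟨hV1, hV2⟩, hVV, -, hAd⟩
  obtain ⟨ζ, hζ, hζ1⟩ := S.exists_unit_vector
  have hUζ : S.U g ζ = ζ := by
    have h2 : S.U g * S.rep S.unitProj = S.rep S.unitProj := S.U_fix g
    have := congrArg (fun T : S.H →L[ℂ] S.H => T ζ) h2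
    change S.U g (S.rep S.unitProj ζ) = S.rep S.unitProj ζ at this
    rwa [hζ] at this
  have hright : ∀ h, S.Tcr ζ h S.unitProj * S.unitProjT = S.Tcr ζ h S.unitProj := fun h => by
    rw [PimsnerSetting.unitProjT, S.Tcr_right, S.unitProj_mul]
  have hleft : ∀ h, S.unitProjT * S.Tcr ζ h S.unitProj = S.Tcr ζ h S.unitProj := fun h => by
    rw [PimsnerSetting.unitProjT, S.Tcr_left, hζ]
  have hiso : ∀ h, star (S.Tcr ζ h S.unitProj) * S.Tcr ζ h S.unitProj = S.unitProjT := fun h => by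
    rw [S.Tcr_star, if_pos rfl, hζ1, one_smul, S.unitProj_star, S.unitProj_mul]
    rfl
  have hcov : ∀ h, S.Tcr ζ (g * h) S.unitProj = V * S.Tcr ζ h S.unitProj * star V := fun h => by
    rw [← hAd _ ⟨hleft h, hright h⟩, S.Γ_cr, hUζ, S.αE_unitProj]
  have hinter : ∀ h, star (S.Tcr ζ (g * h) S.unitProj) * V * S.Tcr ζ h S.unitProj = V := by
    intro h
    have e : V * S.Tcr ζ h S.unitProj = S.Tcr ζ (g * h) S.unitProj * V := by
      rw [hcov h, mul_assoc, hVV, mul_assoc, hright]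
    rw [mul_assoc, e, ← mul_assoc, hiso, hV1]
  have hnorm : ∀ h, ‖S.Tcr ζ h S.unitProj‖ * ‖S.Tcr ζ h S.unitProj‖ = ‖S.unitProjT‖ := fun h => by
    rw [← hiso h, CStarRing.norm_star_mul_self]
  have hnorm' : ∀ h k, ‖S.Tcr ζ h S.unitProj‖ = ‖S.Tcr ζ k S.unitProj‖ := fun h k => by
    have := (hnorm h).trans (hnorm k).symm
    exact (mul_self_inj (norm_nonneg _) (norm_nonneg _)).mp this
  have hbound : ∀ t, S.Good t → ‖V‖ ≤ ‖S.unitProjT‖ * ‖V - t‖ := by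
    intro t ht
    obtain ⟨F, hF⟩ := S.good_compress ζ S.unitProj g hg t ht
    obtain ⟨h, hh⟩ := Infinite.exists_notMem_finset F
    have e : V = star (S.Tcr ζ (g * h) S.unitProj) * (V - t) * S.Tcr ζ h S.unitProj := by
      rw [mul_sub, sub_mul, hinter h, hF h hh, sub_zero]
    calc ‖V‖ = ‖star (S.Tcr ζ (g * h) S.unitProj) * (V - t) * S.Tcr ζ h S.unitProj‖ := by
          rw [← e]
      _ ≤ ‖star (S.Tcr ζ (g * h) S.unitProj)‖ * ‖V - t‖ * ‖S.Tcr ζ h S.unitProj‖ :=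
          (norm_mul_le _ _).trans (mul_le_mul_of_nonneg_right (norm_mul_le _ _) (norm_nonneg _))
      _ = ‖S.unitProjT‖ * ‖V - t‖ := by
          rw [norm_star, hnorm' (g * h) h, ← hnorm h]; ring
  have hV0 : V = 0 := by
    have hclosed : IsClosed {t : S.TX | ‖V‖ ≤ ‖S.unitProjT‖ * ‖V - t‖} :=
      isClosed_le continuous_const (by fun_prop)
    have hmem : V ∈ closure ((NonUnitalStarAlgebra.adjoin ℂ
        {t : S.TX | ∃ ζ h x, t = S.Tcr ζ h x} : NonUnitalStarSubalgebra ℂ S.TX) : Set S.TX) := by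
      rw [S.generates]; trivial
    have h1 : ‖V‖ ≤ ‖S.unitProjT‖ * ‖V - V‖ :=
      closure_minimal (fun t ht => hbound t (S.good_of_mem_adjoin t ht)) hclosed hmem
    rw [sub_self, norm_zero, mul_zero] at h1
    exact norm_le_zero_iff.mp h1
  rw [hV0, mul_zero] at hVV
  exact S.unitProj_ne_zero (S.ιE_inj (by rw [map_zero]; exact hVV.symm))
end

section
/- Under the standing assumptions of the Pimsner construction (see context), the fixed point algebra of the corner A_E := (1_B⊗e₀)(T_X)(1_B⊗e₀) under the action γ^E := Γ| satisfies A_E^{γ^E} = ι(B), where ι : B → A_E, b ↦ b⊗e₀; moreover the vacuum expectation x ↦ ⟨xΩ_X, Ω_X⟩_{𝔽(X)} restricts to a G-equivariant conditional expectation A_E → A_E^{γ^E}. -/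
namespace PimsnerSetting

variable {G : Type} [Group G] [DecidableEq G] (S : PimsnerSetting G)

/-- Products of creation operators. -/
inductive Cw : S.TX → Prop
  | one (ζ : S.H) (h : G) (x : S.E) : Cw (S.Tcr ζ h x)
  | cons (ζ : S.H) (h : G) (x : S.E) (c : S.TX) : Cw c → Cw (S.Tcr ζ h x * c)

/-- Elements starting with a creation operator. -/
def LC (t : S.TX) : Prop :=
  ∃ ζ h x, t = S.Tcr ζ h x ∨ ∃ s, t = S.Tcr ζ h x * s

/-- The words. -/
inductive Wd : S.TX → Prop
  | base (x : S.E) : Wd (S.ιE x)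
  | c (c : S.TX) : S.Cw c → Wd c
  | cs (c : S.TX) : S.Cw c → Wd (star c)
  | cc (c d : S.TX) : S.Cw c → S.Cw d → Wd (c * star d)

variable {S}

lemma Cw.lmul {c : S.TX} (hc : S.Cw c) (a : S.E) : S.Cw (S.ιE a * c) := by
  cases hc with
  | one ζ h x => rw [S.Tcr_left]; exact .one _ _ _
  | cons ζ h x c hc => rw [← mul_assoc, S.Tcr_left]; exact .cons _ _ _ _ hc

lemma Cw.rmul {c : S.TX} (hc : S.Cw c) (a : S.E) : S.Cw (c * S.ιE a) := by
  induction hc with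
  | one ζ h x => rw [S.Tcr_right]; exact .one _ _ _
  | cons ζ h x c hc ih => rw [mul_assoc]; exact .cons _ _ _ _ ih

lemma Cw.mul {c d : S.TX} (hc : S.Cw c) (hd : S.Cw d) : S.Cw (c * d) := by
  induction hc with
  | one ζ h x => exact .cons _ _ _ _ hd
  | cons ζ h x c hc ih => rw [mul_assoc]; exact .cons _ _ _ _ ih

lemma Cw.LC {c : S.TX} (hc : S.Cw c) : S.LC c := by
  cases hc with
  | one ζ h x => exact ⟨_, _, _, .inl rfl⟩
  | cons ζ h x c hc => exact ⟨_, _, _, .inr ⟨_, rfl⟩⟩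

lemma LC.mul {c : S.TX} (hc : S.LC c) (s : S.TX) : S.LC (c * s) := by
  obtain ⟨ζ, h, x, rfl | ⟨t, rfl⟩⟩ := hc
  · exact ⟨_, _, _, .inr ⟨_, rfl⟩⟩
  · exact ⟨_, _, _, .inr ⟨_, mul_assoc _ _ _⟩⟩

lemma LC.lmul {c : S.TX} (hc : S.LC c) (a : S.E) : S.LC (S.ιE a * c) := by
  obtain ⟨ζ, h, x, rfl | ⟨t, rfl⟩⟩ := hc
  · rw [S.Tcr_left]; exact ⟨_, _, _, .inl rfl⟩
  · rw [← mul_assoc, S.Tcr_left]; exact ⟨_, _, _, .inr ⟨_, rfl⟩⟩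

lemma LC.act {c : S.TX} (hc : S.LC c) (g : G) : S.LC (S.Γ.app g c) := by
  obtain ⟨ζ, h, x, rfl | ⟨t, rfl⟩⟩ := hc
  · rw [S.Γ_cr]; exact ⟨_, _, _, .inl rfl⟩
  · rw [map_mul, S.Γ_cr]; exact ⟨_, _, _, .inr ⟨_, rfl⟩⟩

lemma LC.vac {c : S.TX} (hc : S.LC c) : S.vac c = 0 := by
  obtain ⟨ζ, h, x, rfl | ⟨t, rfl⟩⟩ := hc
  · exact S.vac_cr _ _ _
  · exact S.vac_creation _ _ _ _

lemma vac_continuous : Continuous S.vac :=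
  AddMonoidHomClass.continuous_of_bound S.vac 1 (by simpa using S.vac_contractive)

lemma ιE_continuous : Continuous S.ιE :=
  AddMonoidHomClass.continuous_of_bound S.ιE 1
    (by simpa using NonUnitalStarAlgHom.norm_apply_le S.ιE)

lemma Γ_norm (g : G) (t : S.TX) : ‖S.Γ.app g t‖ = ‖t‖ := StarAlgEquiv.norm_map (S.Γ.app g) t

lemma αE_norm (g : G) (t : S.E) : ‖S.αE.app g t‖ = ‖t‖ := StarAlgEquiv.norm_map (S.αE.app g) t

lemma Γ_continuous (g : G) : Continuous (S.Γ.app g) :=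
  (StarAlgEquiv.isometry (S.Γ.app g)).continuous

lemma αE_continuous (g : G) : Continuous (S.αE.app g) :=
  (StarAlgEquiv.isometry (S.αE.app g)).continuous

lemma Tcr_norm (ζ : S.H) (h : G) (x : S.E) : ‖S.Tcr ζ h x‖ ≤ ‖ζ‖ * ‖x‖ := by
  have h1 := S.Tcr_star ζ h x ζ h x
  rw [if_pos rfl] at h1
  have h2 : ‖S.Tcr ζ h x‖ * ‖S.Tcr ζ h x‖ ≤ (‖ζ‖ * ‖x‖) * (‖ζ‖ * ‖x‖) := by
    rw [← CStarRing.norm_star_mul_self, h1, norm_smul, inner_self_eq_norm_sq_to_K]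
    have h3 := NonUnitalStarAlgHom.norm_apply_le S.ιE (star x * x)
    rw [CStarRing.norm_star_mul_self] at h3
    simp only [norm_pow, RCLike.norm_ofReal, abs_norm]
    nlinarith [sq_nonneg ‖ζ‖]
  exact (abs_le_of_sq_le_sq' (by nlinarith) (by positivity)).2

lemma Tcr_negE (ζ : S.H) (h : G) (x y : S.E) :
    S.Tcr ζ h (x - y) = S.Tcr ζ h x - S.Tcr ζ h y := by
  have := S.Tcr_addE ζ h (x - y) y
  rw [sub_add_cancel] at this
  rw [this]; abel

lemma LC.vac_star {c : S.TX} (hc : S.LC c) : S.vac (star c) = 0 := by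
  obtain ⟨ζ, h, x, rfl | ⟨t, rfl⟩⟩ := hc
  · obtain ⟨p, hp, -, hlim⟩ := S.approxE
    have h1 : Filter.Tendsto (fun n => S.Tcr ζ h (x * p n)) Filter.atTop
        (nhds (S.Tcr ζ h x)) := by
      rw [tendsto_iff_norm_sub_tendsto_zero]
      refine squeeze_zero (fun _ => norm_nonneg _) (fun n => ?_)
        (by simpa using (hlim x).const_mul ‖ζ‖)
      rw [norm_sub_rev, ← Tcr_negE]
      refine (Tcr_norm _ _ _).trans ?_
      gcongr
      linarith [norm_nonneg (x - p n * x)]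
    have h2 := (vac_continuous.tendsto _).comp h1.star
    have h3 : (S.vac ∘ fun n => star (S.Tcr ζ h (x * p n))) = fun _ => 0 := by
      funext n
      simp only [Function.comp]
      rw [← S.Tcr_right, star_mul, S.vac_annihilation]
    rw [h3] at h2
    exact tendsto_nhds_unique h2 tendsto_const_nhds
  · rw [star_mul, S.vac_annihilation]

lemma Wd.cases' {t : S.TX} (ht : S.Wd t) : (∃ x, t = S.ιE x) ∨ S.LC t ∨ S.LC (star t) := by
  cases ht with
  | base x => exact .inl ⟨_, rfl⟩
  | c c h => exact .inr (.inl h.LC)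
  | cs c h => exact .inr (.inr (by rw [star_star]; exact h.LC))
  | cc c d hc hd => exact .inr (.inl (hc.LC.mul _))

lemma Wd.cr_mul {t : S.TX} (ht : S.Wd t) (ζ : S.H) (h : G) (x : S.E) :
    S.Wd (S.Tcr ζ h x * t) := by
  cases ht with
  | base y => rw [S.Tcr_right]; exact .c _ (.one _ _ _)
  | c c h => exact .c _ (.cons _ _ _ _ h)
  | cs c h => exact .cc _ _ (.one _ _ _) h
  | cc c d hc hd => rw [← mul_assoc]; exact .cc _ _ (.cons _ _ _ _ hc) hd

lemma cr_star_mul_Cw {c : S.TX} (hc : S.Cw c) (ζ : S.H) (h : G) (x : S.E) :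
    ∃ (z : ℂ) (w : S.TX), star (S.Tcr ζ h x) * c = z • w ∧ (S.Cw w ∨ ∃ y, w = S.ιE y) := by
  cases hc with
  | one ξ k y =>
    rw [S.Tcr_star]
    split_ifs
    · exact ⟨_, _, rfl, .inr ⟨_, rfl⟩⟩
    · exact ⟨0, S.ιE 0, by simp, .inr ⟨_, rfl⟩⟩
  | cons ξ k y c hc =>
    rw [← mul_assoc, S.Tcr_star]
    split_ifs
    · exact ⟨_, _, smul_mul_assoc _ _ _, .inl (hc.lmul _)⟩
    · exact ⟨0, S.ιE 0, by simp, .inr ⟨_, rfl⟩⟩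

lemma Wd.star_cr_mul {t : S.TX} (ht : S.Wd t) (ζ : S.H) (h : G) (x : S.E) :
    ∃ (z : ℂ) (w : S.TX), star (S.Tcr ζ h x) * t = z • w ∧ S.Wd w := by
  cases ht with
  | base y =>
    refine ⟨1, star (S.ιE (star y) * S.Tcr ζ h x), ?_, .cs _ ((Cw.one _ _ _).lmul _)⟩
    rw [star_mul, map_star, star_star, one_smul]
  | c c hc =>
    obtain ⟨z, w, hw, h1 | ⟨y, rfl⟩⟩ := cr_star_mul_Cw hc ζ h x
    · exact ⟨z, w, hw, .c _ h1⟩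
    · exact ⟨z, _, hw, .base _⟩
  | cs c hc =>
    refine ⟨1, star (c * S.Tcr ζ h x), ?_, .cs _ (hc.mul (.one _ _ _))⟩
    rw [star_mul, one_smul]
  | cc c d hc hd =>
    obtain ⟨z, w, hw, h1 | ⟨y, rfl⟩⟩ := cr_star_mul_Cw hc ζ h x
    · exact ⟨z, w * star d, by rw [← mul_assoc, hw, smul_mul_assoc], .cc _ _ h1 hd⟩
    · refine ⟨z, star (d * S.ιE (star y)), ?_, .cs _ (hd.rmul _)⟩
      rw [← mul_assoc, hw, smul_mul_assoc, star_mul, map_star, star_star]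

variable (S)

/-- The span of the words. -/
def wspan : Submodule ℂ S.TX := Submodule.span ℂ {t | S.Wd t}

lemma adjoin_le {t : S.TX} (ht : t ∈ NonUnitalStarAlgebra.adjoin ℂ
      {t : S.TX | ∃ ζ h x, t = S.Tcr ζ h x}) :
    t ∈ S.wspan ∧ ∀ n ∈ S.wspan, t * n ∈ S.wspan := by
  have ht' : t ∈ NonUnitalAlgebra.adjoin ℂ ({t : S.TX | ∃ ζ h x, t = S.Tcr ζ h x} ∪
      star {t : S.TX | ∃ ζ h x, t = S.Tcr ζ h x}) := ht
  clear ht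
  induction ht' using NonUnitalAlgebra.adjoin_induction with
  | mem t ht =>
    have key : ∀ t : S.TX, (∀ w, S.Wd w → t * w ∈ S.wspan) → ∀ n ∈ S.wspan, t * n ∈ S.wspan := by
      intro t ht n hn
      have : S.wspan ≤ S.wspan.comap (LinearMap.mulLeft ℂ t) := Submodule.span_le.2 ht
      exact this hn
    rcases ht with ⟨ζ, h, x, rfl⟩ | ht
    · exact ⟨Submodule.subset_span (.c _ (.one _ _ _)),
        key _ fun w hw => Submodule.subset_span (hw.cr_mul _ _ _)⟩
    · obtain ⟨ζ, h, x, hx⟩ := ht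
      obtain rfl : t = star (S.Tcr ζ h x) := by rw [← hx, star_star]
      refine ⟨Submodule.subset_span (.cs _ (.one _ _ _)), key _ fun w hw => ?_⟩
      obtain ⟨z, v, h1, h2⟩ := hw.star_cr_mul ζ h x
      rw [h1]
      exact Submodule.smul_mem _ _ (Submodule.subset_span h2)
  | add x y hx hy h1 h2 =>
    refine ⟨add_mem h1.1 h2.1, fun n hn => ?_⟩
    rw [add_mul]
    exact add_mem (h1.2 _ hn) (h2.2 _ hn)
  | zero => exact ⟨zero_mem _, fun n _ => by rw [zero_mul]; exact zero_mem _⟩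
  | mul x y hx hy h1 h2 =>
    refine ⟨h1.2 _ h2.1, fun n hn => ?_⟩
    rw [mul_assoc]
    exact h1.2 _ (h2.2 _ hn)
  | smul r x hx h1 =>
    refine ⟨Submodule.smul_mem _ _ h1.1, fun n hn => ?_⟩
    rw [smul_mul_assoc]
    exact Submodule.smul_mem _ _ (h1.2 _ hn)

lemma wspan_dense : Dense (S.wspan : Set S.TX) := by
  rw [dense_iff_closure_eq, ← Set.univ_subset_iff, ← S.generates]
  exact closure_mono fun t ht => (S.adjoin_le ht).1

variable {S}

lemma ext_words (f g : S.TX →ₗ[ℂ] S.E) (hf : Continuous f) (hg : Continuous g)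
    (h0 : ∀ x, f (S.ιE x) = g (S.ιE x)) (h1 : ∀ t, S.LC t → f t = g t)
    (h2 : ∀ t, S.LC t → f (star t) = g (star t)) (t : S.TX) : f t = g t := by
  have : Set.EqOn f g (S.wspan : Set S.TX) := by
    have : S.wspan ≤ LinearMap.eqLocus f g := by
      refine Submodule.span_le.2 fun w hw => ?_
      rcases hw.cases' with ⟨x, rfl⟩ | hw | hw
      · exact h0 x
      · exact h1 _ hw
      · have := h2 _ hw
        rwa [star_star] at this
    exact fun x hx => this hx
  exact congrFun (Continuous.ext_on S.wspan_dense hf hg this) t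

lemma vac_lmul (a : S.E) (t : S.TX) : S.vac (S.ιE a * t) = a * S.vac t := by
  refine ext_words (S.vac ∘ₗ LinearMap.mulLeft ℂ (S.ιE a)) (LinearMap.mulLeft ℂ a ∘ₗ S.vac)
    ?_ ?_ ?_ ?_ ?_ t
  · exact vac_continuous.comp (continuous_const.mul continuous_id)
  · exact continuous_const.mul vac_continuous
  · intro x
    simp [← map_mul, S.vac_ι]
  · intro t ht
    simp [(ht.lmul a).vac, ht.vac]
  · intro t ht
    have := (ht.mul (S.ιE (star a))).vac_star
    rw [star_mul, map_star, star_star] at this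
    simp [this, ht.vac_star]

lemma vac_rmul (a : S.E) (t : S.TX) : S.vac (t * S.ιE a) = S.vac t * a := by
  refine ext_words (S.vac ∘ₗ LinearMap.mulRight ℂ (S.ιE a)) (LinearMap.mulRight ℂ a ∘ₗ S.vac)
    ?_ ?_ ?_ ?_ ?_ t
  · exact vac_continuous.comp (continuous_id.mul continuous_const)
  · exact vac_continuous.mul continuous_const
  · intro x
    simp [← map_mul, S.vac_ι]
  · intro t ht
    simp [(ht.mul (S.ιE a)).vac, ht.vac]
  · intro t ht
    have := (ht.lmul (star a)).vac_star
    rw [star_mul, map_star, star_star] at this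
    simp [this, ht.vac_star]

/-- An automorphism as a linear map. -/
def linOf {A : Type} [NonUnitalCStarAlgebra A] (e : A ≃⋆ₐ[ℂ] A) : A →ₗ[ℂ] A where
  toFun := e
  map_add' := map_add e
  map_smul' := map_smul e

lemma vac_Γ (g : G) (t : S.TX) : S.vac (S.Γ.app g t) = S.αE.app g (S.vac t) := by
  refine ext_words (S.vac ∘ₗ linOf (S.Γ.app g)) (linOf (S.αE.app g) ∘ₗ S.vac)
    ?_ ?_ ?_ ?_ ?_ t
  · exact vac_continuous.comp (Γ_continuous g)
  · exact (αE_continuous g).comp vac_continuous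
  · intro x
    simp [linOf, S.Γ_ι, S.vac_ι]
  · intro t ht
    simp [linOf, (ht.act g).vac, ht.vac]
  · intro t ht
    simp [linOf, map_star, (ht.act g).vac_star, ht.vac_star]

lemma LC.orth {t : S.TX} (ht : S.LC t) {g k : G} (hgk : g ≠ k) :
    star (S.Γ.app g t) * S.Γ.app k t = 0 := by
  have key : ∀ ζ h x ξ y, star (S.Tcr ζ (g * h) x) * S.Tcr ξ (k * h) y = 0 := by
    intro ζ h x ξ y
    rw [S.Tcr_star, if_neg]
    simpa using hgk
  obtain ⟨ζ, h, x, rfl | ⟨s, rfl⟩⟩ := ht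
  · rw [S.Γ_cr, S.Γ_cr, key]
  · rw [map_mul, map_mul, S.Γ_cr, S.Γ_cr, star_mul, mul_assoc, ← mul_assoc (star (S.Tcr _ _ _)),
      key, zero_mul, mul_zero]

lemma norm_sum_sq_le {A : Type} [NonUnitalCStarAlgebra A] (a : ℕ → A)
    (h : ∀ i j, i ≠ j → star (a i) * a j = 0) (M : ℝ) (hM : ∀ i, ‖a i‖ ≤ M) (N : ℕ) :
    ‖∑ i ∈ Finset.range N, a i‖ ^ 2 ≤ N * M ^ 2 := by
  rw [sq, ← CStarRing.norm_star_mul_self]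
  have : star (∑ i ∈ Finset.range N, a i) * (∑ i ∈ Finset.range N, a i)
      = ∑ i ∈ Finset.range N, star (a i) * a i := by
    rw [star_sum, Finset.sum_mul]
    refine Finset.sum_congr rfl fun i hi => ?_
    rw [Finset.mul_sum]
    exact Finset.sum_eq_single_of_mem i hi fun j _ hj => h i j hj.symm
  rw [this]
  refine (norm_sum_le _ _).trans ?_
  have : ∀ i ∈ Finset.range N, ‖star (a i) * a i‖ ≤ M ^ 2 := by
    intro i _
    rw [CStarRing.norm_star_mul_self]
    nlinarith [hM i, norm_nonneg (a i)]
  simpa using Finset.sum_le_sum this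

/-- The defect `t ↦ avg t - ι vac avg t`, as a linear map. -/
noncomputable def defect (g : ℕ → G) (N : ℕ) : S.TX →ₗ[ℂ] S.TX :=
  (N : ℂ)⁻¹ • ∑ i ∈ Finset.range N,
    (linOf (S.Γ.app (g i)) -
      (S.ιE : S.E →ₗ[ℂ] S.TX) ∘ₗ S.vac ∘ₗ linOf (S.Γ.app (g i)))

lemma defect_apply (g : ℕ → G) (N : ℕ) (t : S.TX) :
    defect g N t = (N : ℂ)⁻¹ • ∑ i ∈ Finset.range N,
      (S.Γ.app (g i) t - S.ιE (S.vac (S.Γ.app (g i) t))) := by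
  simp [defect, linOf, LinearMap.sum_apply]

lemma defect_norm (g : ℕ → G) (N : ℕ) (t : S.TX) : ‖defect g N t‖ ≤ 2 * ‖t‖ := by
  rw [defect_apply, norm_smul]
  have h1 : ∀ i ∈ Finset.range N,
      ‖S.Γ.app (g i) t - S.ιE (S.vac (S.Γ.app (g i) t))‖ ≤ 2 * ‖t‖ := by
    intro i _
    refine (norm_sub_le _ _).trans ?_
    have h2 := NonUnitalStarAlgHom.norm_apply_le S.ιE (S.vac (S.Γ.app (g i) t))
    have h3 := S.vac_contractive (S.Γ.app (g i) t)
    rw [Γ_norm] at *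
    linarith
  have h2 := (norm_sum_le _ _).trans (Finset.sum_le_sum h1)
  simp only [Finset.sum_const, Finset.card_range, nsmul_eq_mul] at h2
  rcases Nat.eq_zero_or_pos N with rfl | hN
  · simp
  · have hN' : (0 : ℝ) < N := by exact_mod_cast hN
    rw [norm_inv, Complex.norm_natCast, inv_mul_le_iff₀ hN']
    exact h2

lemma tendsto_avg {A : Type} [NonUnitalCStarAlgebra A] (a : ℕ → A)
    (h : ∀ i j, i ≠ j → star (a i) * a j = 0) (M : ℝ) (hM : ∀ i, ‖a i‖ ≤ M) :
    Filter.Tendsto (fun N : ℕ => (N : ℂ)⁻¹ • ∑ i ∈ Finset.range N, a i) Filter.atTop (nhds 0) := by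
  rw [tendsto_zero_iff_norm_tendsto_zero]
  have h0 : Filter.Tendsto (fun N : ℕ => Real.sqrt ((N : ℝ)⁻¹ * M ^ 2)) Filter.atTop (nhds 0) := by
    have := ((tendsto_inv_atTop_nhds_zero_nat (𝕜 := ℝ)).mul_const (M ^ 2)).sqrt
    simpa using this
  refine squeeze_zero (fun _ => norm_nonneg _) (fun N => ?_) h0
  apply Real.le_sqrt_of_sq_le
  rw [norm_smul, mul_pow, norm_inv, Complex.norm_natCast]
  rcases Nat.eq_zero_or_pos N with rfl | hN
  · simp
  · have hN' : (0 : ℝ) < N := by exact_mod_cast hN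
    calc ((N : ℝ)⁻¹) ^ 2 * ‖∑ i ∈ Finset.range N, a i‖ ^ 2 ≤ ((N : ℝ)⁻¹) ^ 2 * (N * M ^ 2) := by
          gcongr
          exact norm_sum_sq_le a h M hM N
      _ = (N : ℝ)⁻¹ * M ^ 2 := by field_simp

lemma defect_tendsto (g : ℕ → G) (hg : Function.Injective g) (t : S.TX) (ht : t ∈ S.wspan) :
    Filter.Tendsto (fun N => defect g N t) Filter.atTop (nhds 0) := by
  induction ht using Submodule.span_induction with
  | mem t ht =>
    rcases ht.cases' with ⟨x, rfl⟩ | ht | ht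
    · simp [defect_apply, S.Γ_ι, S.vac_ι]
    · simp only [defect_apply, (ht.act _).vac, map_zero, sub_zero]
      exact tendsto_avg _ (fun i j hij => ht.orth (hg.ne hij)) ‖t‖ (fun i => (Γ_norm _ _).le)
    · obtain ⟨s, rfl⟩ : ∃ s, t = star s := ⟨star t, (star_star t).symm⟩
      rw [star_star] at ht
      simp only [defect_apply, map_star, (ht.act _).vac_star, map_zero, sub_zero]
      have h1 : ∀ i, S.vac (star (S.Γ.app (g i) s)) = 0 := fun i => (ht.act _).vac_star
      have := (tendsto_avg _ (fun i j hij => ht.orth (hg.ne hij)) ‖s‖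
        (fun i => (Γ_norm (g i) s).le)).star
      simpa [star_smul, star_sum] using this
  | zero => simp
  | add x y _ _ h1 h2 => simpa using h1.add h2
  | smul c x _ h1 => simpa using h1.const_smul c

lemma fixed_eq [Infinite G] (y : S.TX) (hy : ∀ g, S.Γ.app g y = y) : y = S.ιE (S.vac y) := by
  let g : ℕ → G := Infinite.natEmbedding G
  have hg : Function.Injective g := (Infinite.natEmbedding G).injective
  rw [← sub_eq_zero, ← norm_le_zero_iff]
  refine le_of_forall_pos_le_add fun ε hε => ?_
  obtain ⟨y0, hy0, hd⟩ := Metric.mem_closure_iff.1 (S.wspan_dense y) (ε / 3) (by positivity)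
  have h1 := (defect_tendsto g hg y0 hy0).norm
  rw [norm_zero] at h1
  obtain ⟨N, hN, hN1⟩ := ((h1.eventually_lt_const (show (0 : ℝ) < ε / 3 by positivity)).and
    (Filter.eventually_ge_atTop 1)).exists
  have h2 : defect g N y = y - S.ιE (S.vac y) := by
    rw [defect_apply]
    simp only [hy, Finset.sum_const, Finset.card_range]
    have : (N : ℂ) ≠ 0 := by
      have : N ≠ 0 := by omega
      exact_mod_cast this
    rw [← Nat.cast_smul_eq_nsmul ℂ, smul_smul, inv_mul_cancel₀ this, one_smul]
  rw [← h2]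
  have h3 : defect g N y = defect g N (y - y0) + defect g N y0 := by rw [← map_add, sub_add_cancel]
  rw [h3]
  have h4 := defect_norm g N (y - y0)
  rw [dist_eq_norm] at hd
  have := norm_add_le (defect g N (y - y0)) (defect g N y0)
  linarith

lemma BK_corner (y : S.BK) :
    ∃ b, S.stab.θ 0 0 1 * y * S.stab.θ 0 0 1 = S.stab.θ 0 0 b := by
  have hcl : IsClosed (Set.range (S.stab.θ 0 0)) := by
    have hi : Isometry (S.stab.θ 0 0) :=
      AddMonoidHomClass.isometry_of_norm _ (S.stab.norm_rel 0 0)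
    exact hi.isClosedEmbedding.isClosed_range
  have hcl2 : IsClosed {y : S.BK |
      S.stab.θ 0 0 1 * y * S.stab.θ 0 0 1 ∈ Set.range (S.stab.θ 0 0)} :=
    hcl.preimage ((continuous_const.mul continuous_id).mul continuous_const)
  have hsp : Submodule.span ℂ (⋃ i : ℕ, ⋃ j : ℕ, Set.range (S.stab.θ i j)) ≤
      (LinearMap.range (S.stab.θ 0 0)).comap
        (LinearMap.mulRight ℂ (S.stab.θ 0 0 1) ∘ₗ LinearMap.mulLeft ℂ (S.stab.θ 0 0 1)) := by
    refine Submodule.span_le.2 ?_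
    intro z hz
    simp only [Set.mem_iUnion, Set.mem_range] at hz
    obtain ⟨i, j, b, rfl⟩ := hz
    simp only [SetLike.mem_coe, Submodule.mem_comap, LinearMap.comp_apply,
      LinearMap.mulLeft_apply, LinearMap.mulRight_apply, LinearMap.mem_range]
    rw [S.stab.mul_rel]
    split_ifs with h
    · rw [S.stab.mul_rel]
      split_ifs
      · exact ⟨_, rfl⟩
      · exact ⟨0, map_zero _⟩
    · exact ⟨0, by rw [map_zero, zero_mul]⟩
  have hall : y ∈ closure ((Submodule.span ℂ (⋃ i : ℕ, ⋃ j : ℕ, Set.range (S.stab.θ i j)) :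
      Submodule ℂ S.BK) : Set S.BK) := by
    rw [S.stab.dense]; trivial
  have := closure_minimal (fun z hz => hsp hz) hcl2 hall
  obtain ⟨b, hb⟩ := this
  exact ⟨b, hb.symm⟩

lemma E_corner (e : S.E) (h1 : S.unitProj * e = e) (h2 : e * S.unitProj = e) :
    ∃ b, e = S.jBK (S.stab.θ 0 0 b) := by
  obtain ⟨y, hy⟩ := S.ideal_right e (S.stab.θ 0 0 1)
  obtain ⟨b, hb⟩ := BK_corner y
  refine ⟨b, ?_⟩
  rw [← hb, map_mul, map_mul, hy]
  change e = S.unitProj * (S.unitProj * e) * S.unitProj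
  rw [h1, h1, h2]

lemma cornerEmb_mem (b : S.B) : S.cornerEmb b ∈ S.corner := by
  constructor <;>
    simp [unitProjT, unitProj, cornerEmb, ← map_mul, S.stab.mul_rel]

lemma αE_fix (g : G) (b : S.B) :
    S.αE.app g (S.jBK (S.stab.θ 0 0 b)) = S.jBK (S.stab.θ 0 0 b) := by
  apply S.rep_inj
  rw [S.αE_rep]
  set p := S.rep (S.jBK (S.stab.θ 0 0 1)) with hp
  have hl : S.rep (S.jBK (S.stab.θ 0 0 b)) = p * S.rep (S.jBK (S.stab.θ 0 0 b)) := by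
    rw [hp, ← map_mul, ← map_mul, S.stab.mul_rel, if_pos rfl, one_mul]
  have hr : S.rep (S.jBK (S.stab.θ 0 0 b)) = S.rep (S.jBK (S.stab.θ 0 0 b)) * p := by
    rw [hp, ← map_mul, ← map_mul, S.stab.mul_rel, if_pos rfl, mul_one]
  have hps : star p = p := by
    rw [hp, ← map_star, ← map_star, S.stab.star_rel, star_one]
  have hu : p * star (S.U g) = p := by
    have := congrArg star (S.U_fix g)
    rwa [star_mul, hps] at this
  rw [hl, ← mul_assoc, S.U_fix, ← hp, ← hl, hr, mul_assoc, hu]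

end PimsnerSetting

/-- Under the standing assumptions of the Pimsner construction, the
fixed point algebra of the corner `A_E = (1_B⊗e₀) T_X (1_B⊗e₀)` under `γ^E = Γ|` is
`ι(B)` (`ι : b ↦ b ⊗ e₀`), and the vacuum expectation `x ↦ ⟨xΩ_X, Ω_X⟩` restricts to a
`G`-equivariant conditional expectation `A_E → A_E^{γ^E}`. -/
theorem pimsner_corner_fixed_points_and_expectation
    (G : Type) [Group G] [DecidableEq G] [Countable G] [Infinite G]
    (S : PimsnerSetting G) :
    ({y : S.TX | y ∈ S.corner ∧ ∀ g : G, S.Γ.app g y = y} = Set.range S.cornerEmb) ∧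
    ∃ P : S.TX →ₗ[ℂ] S.TX,
      (∀ y : S.TX, P y = S.ιE (S.vac y)) ∧
      (∀ y ∈ S.corner, P y ∈ Set.range S.cornerEmb) ∧
      (∀ y ∈ Set.range S.cornerEmb, P y = y) ∧
      (∀ y ∈ S.corner, ‖P y‖ ≤ ‖y‖) ∧
      (∀ y ∈ S.corner, ∃ c : S.TX, P (star y * y) = star c * c) ∧
      (∀ b ∈ Set.range S.cornerEmb, ∀ y ∈ S.corner,
        P (b * y) = b * P y ∧ P (y * b) = P y * b) ∧
      (∀ (g : G), ∀ y ∈ S.corner, P (S.Γ.app g y) = S.Γ.app g (P y)) := by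
  have hcorner : ∀ y ∈ S.corner, ∃ b, S.cornerEmb b = S.ιE (S.vac y) := by
    intro y hy
    obtain ⟨b, hb⟩ := PimsnerSetting.E_corner (S.vac y)
      (by rw [← PimsnerSetting.vac_lmul]; exact congrArg S.vac hy.1)
      (by rw [← PimsnerSetting.vac_rmul]; exact congrArg S.vac hy.2)
    exact ⟨b, by rw [hb]; rfl⟩
  refine ⟨?_, (S.ιE : S.E →ₗ[ℂ] S.TX) ∘ₗ S.vac, fun y => rfl, ?_, ?_, ?_, ?_, ?_, ?_⟩
  · ext y
    constructor
    · rintro ⟨hy, hf⟩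
      obtain ⟨b, hb⟩ := hcorner y hy
      exact ⟨b, hb.trans (PimsnerSetting.fixed_eq y hf).symm⟩
    · rintro ⟨b, rfl⟩
      refine ⟨PimsnerSetting.cornerEmb_mem b, fun g => ?_⟩
      rw [PimsnerSetting.cornerEmb, S.Γ_ι, PimsnerSetting.αE_fix]
  · exact hcorner
  · rintro _ ⟨b, rfl⟩
    change S.ιE (S.vac (S.ιE _)) = S.ιE _
    rw [S.vac_ι]
  · intro y _
    exact (NonUnitalStarAlgHom.norm_apply_le S.ιE _).trans (S.vac_contractive y)
  · intro y _
    obtain ⟨c, hc⟩ := S.vac_positive y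
    refine ⟨S.ιE c, ?_⟩
    change S.ιE (S.vac _) = _
    rw [hc, map_mul, map_star]
  · rintro _ ⟨b, rfl⟩ y _
    constructor
    · change S.ιE (S.vac (S.ιE _ * y)) = S.ιE _ * S.ιE _
      rw [PimsnerSetting.vac_lmul, map_mul]
    · change S.ιE (S.vac (y * S.ιE _)) = S.ιE _ * S.ιE _
      rw [PimsnerSetting.vac_rmul, map_mul]
  · intro g y _
    change S.ιE (S.vac _) = S.Γ.app g (S.ιE _)
    rw [PimsnerSetting.vac_Γ, S.Γ_ι]
end

section
/- Under the standing assumptions of the Pimsner construction (see context), let β_z, z ∈ 𝕋, be the gauge action on T_X determined by β_z(T_{ζ⊗δ_h⊗x}) = z·T_{ζ⊗δ_h⊗x}, which restricts to the corner A_E := (1_B⊗e₀)(T_X)(1_B⊗e₀). If g ∈ G and V is a unitary of A_E with Ad V = γ^E_g, where γ^E := Γ| is the restriction of the quasi-free G-action, then β_z(V) = V for all z ∈ 𝕋. -/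
namespace PimsnerSetting

variable {G : Type} [Group G] [DecidableEq G] (S : PimsnerSetting G)

/-- Normally ordered monomials. -/
inductive NO : S.TX → Prop
  | ι (e : S.E) : NO (S.ιE e)
  | cr (ζ : S.H) (h : G) (x : S.E) : NO (S.Tcr ζ h x)
  | an (ζ : S.H) (h : G) (x : S.E) : NO (star (S.Tcr ζ h x))
  | cons (ζ : S.H) (h : G) (x : S.E) (t : S.TX) : NO t → NO (S.Tcr ζ h x * t)
  | snoc (ζ : S.H) (h : G) (x : S.E) (t : S.TX) : NO t → NO (t * star (S.Tcr ζ h x))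

/-- Span of the normally ordered monomials. -/
def nspan : Submodule ℂ S.TX := Submodule.span ℂ {t | S.NO t}

lemma nspan_left (a : S.TX) (h : ∀ t, S.NO t → a * t ∈ S.nspan) :
    ∀ t ∈ S.nspan, a * t ∈ S.nspan := by
  intro t ht
  induction ht using Submodule.span_induction with
  | mem x hx => exact h x hx
  | zero => simp
  | add x y _ _ hx hy => rw [mul_add]; exact add_mem hx hy
  | smul c x _ hx => rw [mul_smul_comm]; exact Submodule.smul_mem _ c hx

lemma nspan_snoc (ζ : S.H) (h : G) (x : S.E) :
    ∀ t ∈ S.nspan, t * star (S.Tcr ζ h x) ∈ S.nspan := by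
  intro t ht
  induction ht using Submodule.span_induction with
  | mem y hy => exact Submodule.subset_span (NO.snoc ζ h x y hy)
  | zero => simp
  | add x y _ _ hx hy => rw [add_mul]; exact add_mem hx hy
  | smul c x _ hx => rw [smul_mul_assoc]; exact Submodule.smul_mem _ c hx

lemma NO.mem {S : PimsnerSetting G} {t : S.TX} (h : S.NO t) : t ∈ S.nspan :=
  Submodule.subset_span h

lemma left_cr (ζ : S.H) (h : G) (x : S.E) :
    ∀ t ∈ S.nspan, S.Tcr ζ h x * t ∈ S.nspan :=
  S.nspan_left _ fun t ht => (NO.cons ζ h x t ht).mem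

lemma left_ι_NO (e : S.E) (t : S.TX) (ht : S.NO t) : S.ιE e * t ∈ S.nspan := by
  induction ht with
  | ι f => rw [← map_mul]; exact (NO.ι _).mem
  | cr ζ h x => rw [S.Tcr_left]; exact (NO.cr _ _ _).mem
  | an ζ h x =>
    have : S.ιE e * star (S.Tcr ζ h x) = star (S.Tcr ζ h (x * star e)) := by
      rw [← S.Tcr_right, star_mul, map_star, star_star]
    rw [this]; exact (NO.an _ _ _).mem
  | cons ζ h x t ht _ => rw [← mul_assoc, S.Tcr_left]; exact (NO.cons _ _ _ _ ht).mem
  | snoc ζ h x t _ ih => rw [← mul_assoc]; exact S.nspan_snoc _ _ _ _ ih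

lemma left_an_NO (ξ : S.H) (k : G) (y : S.E) (t : S.TX) (ht : S.NO t) :
    star (S.Tcr ξ k y) * t ∈ S.nspan := by
  induction ht with
  | ι f =>
    have : star (S.Tcr ξ k y) * S.ιE f = star (S.Tcr (S.rep (star f) ξ) k y) := by
      rw [← S.Tcr_left, star_mul, map_star, star_star]
    rw [this]; exact (NO.an _ _ _).mem
  | cr ζ h x =>
    rw [S.Tcr_star]
    split_ifs
    · exact Submodule.smul_mem _ _ (NO.ι _).mem
    · exact zero_mem _
  | an ζ h x => exact (NO.snoc _ _ _ _ (NO.an _ _ _)).mem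
  | cons ζ h x t ht _ =>
    rw [← mul_assoc, S.Tcr_star]
    split_ifs
    · rw [smul_mul_assoc]; exact Submodule.smul_mem _ _ (S.left_ι_NO _ _ ht)
    · rw [zero_mul]; exact zero_mem _
  | snoc ζ h x t _ ih => rw [← mul_assoc]; exact S.nspan_snoc _ _ _ _ ih

lemma adjoin_sub (a : S.TX) (ha : a ∈ NonUnitalStarAlgebra.adjoin ℂ
      {t : S.TX | ∃ ζ h x, t = S.Tcr ζ h x}) :
    (a ∈ S.nspan ∧ ∀ t ∈ S.nspan, a * t ∈ S.nspan) ∧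
    (star a ∈ S.nspan ∧ ∀ t ∈ S.nspan, star a * t ∈ S.nspan) := by
  induction ha using NonUnitalStarAlgebra.adjoin_induction with
  | mem x hx =>
    obtain ⟨ζ, h, x, rfl⟩ := hx
    exact ⟨⟨(NO.cr _ _ _).mem, S.left_cr _ _ _⟩, (NO.an _ _ _).mem,
      S.nspan_left _ (S.left_an_NO _ _ _)⟩
  | add x y _ _ hx hy =>
    refine ⟨⟨add_mem hx.1.1 hy.1.1, fun t ht => ?_⟩, ?_, fun t ht => ?_⟩
    · rw [add_mul]; exact add_mem (hx.1.2 t ht) (hy.1.2 t ht)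
    · rw [star_add]; exact add_mem hx.2.1 hy.2.1
    · rw [star_add, add_mul]; exact add_mem (hx.2.2 t ht) (hy.2.2 t ht)
  | zero => simp
  | mul x y _ _ hx hy =>
    refine ⟨⟨hx.1.2 _ hy.1.1, fun t ht => ?_⟩, ?_, fun t ht => ?_⟩
    · rw [mul_assoc]; exact hx.1.2 _ (hy.1.2 t ht)
    · rw [star_mul]; exact hy.2.2 _ hx.2.1
    · rw [star_mul, mul_assoc]; exact hy.2.2 _ (hx.2.2 t ht)
  | smul c x _ hx =>
    refine ⟨⟨Submodule.smul_mem _ c hx.1.1, fun t ht => ?_⟩, ?_, fun t ht => ?_⟩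
    · rw [smul_mul_assoc]; exact Submodule.smul_mem _ c (hx.1.2 t ht)
    · rw [star_smul]; exact Submodule.smul_mem _ _ hx.2.1
    · rw [star_smul, smul_mul_assoc]; exact Submodule.smul_mem _ _ (hx.2.2 t ht)
  | star x _ hx => rw [star_star]; exact ⟨hx.2, hx.1⟩

lemma compress_NO (t : S.TX) (ht : S.NO t) :
    ∃ F : Finset G, ∀ h ∉ F, ∀ k ∉ F, ∀ ζ ξ x y,
      ∃ e, star (S.Tcr ζ k x) * t * S.Tcr ξ h y = S.ιE e := by
  cases ht with
  | ι f =>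
    refine ⟨∅, fun h _ k _ ζ ξ x y => ?_⟩
    rw [mul_assoc, S.Tcr_left, S.Tcr_star]
    split_ifs
    · exact ⟨_, (map_smul S.ιE _ _).symm⟩
    · exact ⟨0, (map_zero S.ιE).symm⟩
  | cr ζ₁ h₁ x₁ =>
    refine ⟨{h₁}, fun h _ k hk ζ ξ x y => ⟨0, ?_⟩⟩
    rw [S.Tcr_star, if_neg (by simpa using hk), zero_mul, map_zero]
  | an ζ₁ h₁ x₁ =>
    refine ⟨{h₁}, fun h hh k _ ζ ξ x y => ⟨0, ?_⟩⟩
    rw [mul_assoc, S.Tcr_star, if_neg (fun e => hh (by simp [e])), mul_zero, map_zero]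
  | cons ζ₁ h₁ x₁ t =>
    refine ⟨{h₁}, fun h _ k hk ζ ξ x y => ⟨0, ?_⟩⟩
    rw [← mul_assoc, S.Tcr_star, if_neg (by simpa using hk), zero_mul, zero_mul, map_zero]
  | snoc ζ₁ h₁ x₁ t =>
    refine ⟨{h₁}, fun h hh k _ ζ ξ x y => ⟨0, ?_⟩⟩
    rw [mul_assoc, mul_assoc, S.Tcr_star, if_neg (fun e => hh (by simp [e])), mul_zero,
      mul_zero, map_zero]

lemma compress (t : S.TX) (ht : t ∈ S.nspan) :
    ∃ F : Finset G, ∀ h ∉ F, ∀ k ∉ F, ∀ ζ ξ x y,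
      ∃ e, star (S.Tcr ζ k x) * t * S.Tcr ξ h y = S.ιE e := by
  induction ht using Submodule.span_induction with
  | mem x hx => exact S.compress_NO x hx
  | zero => exact ⟨∅, fun _ _ _ _ _ _ _ _ => ⟨0, by simp⟩⟩
  | add a b _ _ ha hb =>
    obtain ⟨F, hF⟩ := ha
    obtain ⟨F', hF'⟩ := hb
    refine ⟨F ∪ F', fun h hh k hk ζ ξ x y => ?_⟩
    rw [Finset.notMem_union] at hh hk
    obtain ⟨e, he⟩ := hF h hh.1 k hk.1 ζ ξ x y
    obtain ⟨f, hf⟩ := hF' h hh.2 k hk.2 ζ ξ x y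
    exact ⟨e + f, by rw [mul_add, add_mul, he, hf, map_add]⟩
  | smul c a _ ha =>
    obtain ⟨F, hF⟩ := ha
    refine ⟨F, fun h hh k hk ζ ξ x y => ?_⟩
    obtain ⟨e, he⟩ := hF h hh k hk ζ ξ x y
    exact ⟨c • e, by rw [mul_smul_comm, smul_mul_assoc, he, map_smul]⟩

end PimsnerSetting

/-- In the Pimsner setting, if a unitary `V` of the corner
`A_E = (1_B⊗e₀) T_X (1_B⊗e₀)` implements `γ^E_g = Ad V` on the corner, then `V` is
invariant under the gauge action: `β_z(V) = V` for all `z ∈ 𝕋`. -/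
theorem pimsner_implementing_unitary_gauge_invariant
    (G : Type) [Group G] [DecidableEq G] [Countable G] [Infinite G]
    (S : PimsnerSetting G) (g : G) (V : S.TX)
    (hV : V ∈ S.corner)
    (hViso : star V * V = S.unitProjT) (hVcoiso : V * star V = S.unitProjT)
    (hAd : ∀ y ∈ S.corner, S.Γ.app g y = V * y * star V) :
    ∀ z : Circle, S.gauge.app z V = V := by
  by_cases hp : S.unitProj = 0
  · intro z
    have : V = 0 := by
      rw [← hV.1, PimsnerSetting.unitProjT, hp, map_zero, zero_mul]
    rw [this, map_zero]
  have hrp : S.rep S.unitProj ≠ 0 := fun h => hp (S.rep_inj (by rw [h, map_zero]))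
  obtain ⟨ζ₀, hζ₀⟩ : ∃ ζ₀, S.rep S.unitProj ζ₀ ≠ 0 := by
    by_contra! h
    exact hrp (ContinuousLinearMap.ext h)
  obtain ⟨ζ, hpζ, hζ⟩ : ∃ ζ, S.rep S.unitProj ζ = ζ ∧ inner ℂ ζ ζ = (1 : ℂ) := by
    refine ⟨((‖S.rep S.unitProj ζ₀‖⁻¹ : ℝ) : ℂ) • S.rep S.unitProj ζ₀, ?_, ?_⟩
    · rw [map_smul, ← ContinuousLinearMap.mul_apply, ← map_mul, S.unitProj_mul]
    · rw [inner_self_eq_norm_sq_to_K, norm_smul]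
      have : ‖S.rep S.unitProj ζ₀‖ ≠ 0 := norm_ne_zero_iff.mpr hζ₀
      simp [this]
  have hUζ : S.U g ζ = ζ := by
    have h1 : S.U g * S.rep S.unitProj = S.rep S.unitProj := S.U_fix g
    have := congrArg (fun f => f ζ) h1
    simpa [hpζ] using this
  have hTT : ∀ h, star (S.Tcr ζ h S.unitProj) * S.Tcr ζ h S.unitProj = S.unitProjT := by
    intro h
    rw [S.Tcr_star, if_pos rfl, hζ, one_smul, S.unitProj_star, S.unitProj_mul]
    rfl
  have hnorm : ∀ h, ‖S.Tcr ζ h S.unitProj‖ = Real.sqrt ‖S.unitProjT‖ := by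
    intro h
    rw [← hTT h, CStarRing.norm_star_mul_self, Real.sqrt_mul_self (norm_nonneg _)]
  have hcorner : ∀ h, S.Tcr ζ h S.unitProj ∈ S.corner := by
    intro h
    constructor
    · rw [PimsnerSetting.unitProjT, S.Tcr_left, hpζ]
    · rw [PimsnerSetting.unitProjT, S.Tcr_right, S.unitProj_mul]
  have hcomp : ∀ h, star (S.Tcr ζ (g * h) S.unitProj) * V * S.Tcr ζ h S.unitProj = V := by
    intro h
    have h1 := hAd _ (hcorner h)
    rw [S.Γ_cr, hUζ, S.αE_unitProj] at h1
    have h2 : S.Tcr ζ (g * h) S.unitProj * V = V * S.Tcr ζ h S.unitProj := by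
      rw [h1, mul_assoc, hViso, mul_assoc, (hcorner h).2]
    rw [mul_assoc, ← h2, ← mul_assoc, hTT, hV.1]
  intro z
  have hclosed : IsClosed {t : S.TX | S.gauge.app z t = t} :=
    isClosed_eq (StarAlgEquiv.isometry (S.gauge.app z)).continuous continuous_id
  have hmem : V ∈ closure {t : S.TX | S.gauge.app z t = t} := by
    rw [Metric.mem_closure_iff]
    intro ε hε
    have hVc : V ∈ closure ((NonUnitalStarAlgebra.adjoin ℂ
      {t : S.TX | ∃ ζ h x, t = S.Tcr ζ h x} : NonUnitalStarSubalgebra ℂ S.TX) : Set S.TX) := by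
      rw [S.generates]; trivial
    have hC : 0 < ‖S.unitProjT‖ + 1 := by positivity
    obtain ⟨t, ht, hVt⟩ := Metric.mem_closure_iff.1 hVc (ε / (‖S.unitProjT‖ + 1)) (by positivity)
    obtain ⟨F, hF⟩ := S.compress t (S.adjoin_sub t ht).1.1
    obtain ⟨h, hh⟩ := Infinite.exists_notMem_finset (F ∪ F.image (fun k => g⁻¹ * k))
    rw [Finset.notMem_union] at hh
    have hgh : g * h ∉ F := fun hm => hh.2 (Finset.mem_image.2 ⟨g * h, hm, by simp⟩)
    obtain ⟨e, he⟩ := hF h hh.1 (g * h) hgh ζ ζ S.unitProj S.unitProj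
    refine ⟨S.ιE e, S.gauge_ι z e, ?_⟩
    rw [dist_eq_norm] at hVt ⊢
    have h3 : V - S.ιE e =
        star (S.Tcr ζ (g * h) S.unitProj) * (V - t) * S.Tcr ζ h S.unitProj := by
      rw [mul_sub, sub_mul, hcomp, he]
    have h4 : ‖V - S.ιE e‖ ≤ ‖S.unitProjT‖ * ‖V - t‖ := by
      rw [h3]
      refine (norm_mul_le _ _).trans ?_
      refine (mul_le_mul_of_nonneg_right (norm_mul_le _ _) (norm_nonneg _)).trans ?_
      rw [norm_star, hnorm, hnorm]
      have := Real.mul_self_sqrt (norm_nonneg S.unitProjT)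
      rw [mul_right_comm, this]
    rw [lt_div_iff₀ hC] at hVt
    nlinarith [norm_nonneg (V - t)]
  rw [hclosed.closure_eq] at hmem
  exact hmem
end
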